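/- arXiv:2104.12718 — 5 statements merged into one kernel-verified Lean document; each statement's English description precedes it below -/
import Mathlib

section
/- For all sufficiently large n the following holds. Let D ⊆ [n] with |D| ≤ 3n/4, let 𝒫 = (D₁,…,D₆) be an equitable partition of D into six parts, and let y, z ∈ [n] be distinct. Then every H ∈ 𝒢_D contains a well-spread collection of r_{(y,z,𝒫)}(H) distinct (y,z)-bridging gadgets. -/
open scoped Classical

noncomputable section

namespace RandomLatin

/-- `φ` is a proper `n`-arc-colouring of the complete digraph with loops on `Fin n`:
`φ i j` is the colour of the arc `i → j`, and no two arcs of the same colour share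
a common tail or a common head. -/
def IsProper {n : ℕ} (φ : Fin n → Fin n → Fin n) : Prop :=
  (∀ i j j' : Fin n, φ i j = φ i j' → j = j') ∧
  (∀ i i' j : Fin n, φ i j = φ i' j → i = i')

/-- The set `Φ(K_n^↔)` of proper `n`-arc-colourings of the complete digraph with loops. -/
abbrev Colouring (n : ℕ) : Type := {φ : Fin n → Fin n → Fin n // IsProper φ}

/-- `L` is an `n × n` Latin square with symbols `Fin n`. -/
def IsLatin {n : ℕ} (L : Fin n → Fin n → Fin n) : Prop :=
  (∀ i, Function.Bijective (L i)) ∧ (∀ j, Function.Bijective fun i => L i j)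

abbrev LatinSquare (n : ℕ) : Type := {L : Fin n → Fin n → Fin n // IsLatin L}

/-- The set of positions `{(i, σ i) : i}` is a (full) transversal of `L`. -/
def IsTransversal {n : ℕ} (L : Fin n → Fin n → Fin n) (σ : Equiv.Perm (Fin n)) : Prop :=
  Function.Bijective fun i => L i (σ i)

/-- A transversal is Hamilton if its arc set `{i → σ i}` is a directed Hamilton cycle. -/
def IsHamiltonTransversal {n : ℕ} (L : Fin n → Fin n → Fin n) (σ : Equiv.Perm (Fin n)) :
    Prop :=
  IsTransversal L σ ∧ σ.IsCycle ∧ σ.support = Finset.univ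

def hamTransversalCount {n : ℕ} (L : Fin n → Fin n → Fin n) : ℕ :=
  Nat.card {σ : Equiv.Perm (Fin n) // IsHamiltonTransversal L σ}

/-- The number of rainbow directed Hamilton cycles of a coloured `K_n^↔`. -/
def rainbowHamCycleCount {n : ℕ} (φ : Fin n → Fin n → Fin n) : ℕ :=
  Nat.card {σ : Equiv.Perm (Fin n) //
    Function.Injective (fun i => φ i (σ i)) ∧ σ.IsCycle ∧ σ.support = Finset.univ}

/-- The maximum number of appearances of a symbol on the leading diagonal. -/
def diagMax {n : ℕ} (L : Fin n → Fin n → Fin n) : ℕ :=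
  Finset.univ.sup fun s : Fin n => (Finset.univ.filter fun i : Fin n => L i i = s).card

/-! ### The spaces `𝒢_D` -/

/-- `𝒢_D`: proper arc-colourings, with colour set `D`, of spanning subdigraphs of `K_n^↔`
in which every vertex has in- and out-degree `|D|`.  `f d i` is the head of the unique
`d`-coloured arc with tail `i`. -/
def GD (n : ℕ) (D : Finset (Fin n)) : Type :=
  {f : {d : Fin n // d ∈ D} → Fin n → Fin n //
    (∀ d, Function.Bijective (f d)) ∧ ∀ i : Fin n, Function.Injective fun d => f d i}

/-- `comp H`: the number of completions of `H ∈ 𝒢_D` to an element of `Φ(K_n^↔)`,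
i.e. the number of `g ∈ 𝒢_{Dᶜ}` whose arc set is disjoint from that of `H`. -/
def completionCount {n : ℕ} {D : Finset (Fin n)} (H : GD n D) : ℕ :=
  Nat.card {g : GD n Dᶜ //
    ∀ (d : {d : Fin n // d ∈ D}) (d' : {d : Fin n // d ∈ Dᶜ}) (i : Fin n),
      H.1 d i ≠ g.1 d' i}

/-- `e_H(A₁, A₂)`: the number of arcs of `H` with tail in `A₁` and head in `A₂`. -/
def eArcs {n : ℕ} {D : Finset (Fin n)} (H : GD n D) (A₁ A₂ : Finset (Fin n)) : ℕ :=
  Nat.card {p : {d : Fin n // d ∈ D} × Fin n // p.2 ∈ A₁ ∧ H.1 p.1 p.2 ∈ A₂}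

/-! ### Absorbing gadgets -/

/-- A `(v,c)`-absorbing gadget, recorded by its vertices `x 0 = x₁, …, x 5 = x₆`. -/
def IsAbsGadget {n : ℕ} (φ : Fin n → Fin n → Fin n) (v c : Fin n) (x : Fin 6 → Fin n) :
    Prop :=
  ([v, x 0, x 1, x 2, x 3, x 4, x 5] : List (Fin n)).Nodup ∧
  φ (x 0) v = φ (x 3) (x 5) ∧
  φ v (x 1) = φ (x 2) (x 4) ∧
  φ (x 0) (x 1) = φ (x 2) (x 3) ∧
  φ (x 4) (x 5) = c ∧
  ([φ (x 0) v, φ v (x 1), φ (x 0) (x 1), c] : List (Fin n)).Nodup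

def absGadgetVerts {n : ℕ} (v : Fin n) (x : Fin 6 → Fin n) : Finset (Fin n) :=
  insert v (Finset.image x Finset.univ)

/-- The gadget contains an arc of colour `d`. -/
def absGadgetHasColour {n : ℕ} (φ : Fin n → Fin n → Fin n) (v : Fin n)
    (x : Fin 6 → Fin n) (d : Fin n) : Prop :=
  d = φ (x 0) v ∨ d = φ v (x 1) ∨ d = φ (x 0) (x 1) ∨ d = φ (x 2) (x 3) ∨
  d = φ (x 2) (x 4) ∨ d = φ (x 3) (x 5) ∨ d = φ (x 4) (x 5)

def WellSpreadAbsGadgets {n : ℕ} (φ : Fin n → Fin n → Fin n) (v c : Fin n)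
    (𝒜 : Finset (Fin 6 → Fin n)) : Prop :=
  (∀ u : Fin n, u ≠ v → (𝒜.filter fun x => u ∈ absGadgetVerts v x).card ≤ n) ∧
  (∀ d : Fin n, d ≠ c → (𝒜.filter fun x => absGadgetHasColour φ v x d).card ≤ n)

/-! ### Bridging gadgets (with respect to a full colouring) -/

/-- A `(y,z)`-bridging gadget, recorded by its vertices `w 0 = w₁, …, w 5 = w₆`. -/
def IsBridgeGadget {n : ℕ} (φ : Fin n → Fin n → Fin n) (y z : Fin n)
    (w : Fin 6 → Fin n) : Prop :=
  ([y, z, w 0, w 1, w 2, w 3, w 4, w 5] : List (Fin n)).Nodup ∧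
  φ y (w 0) = φ (w 5) (w 4) ∧
  φ (w 1) (w 0) = φ (w 5) z ∧
  φ (w 3) y = φ (w 1) (w 2) ∧
  φ (w 3) (w 4) = φ z (w 2) ∧
  ([φ y (w 0), φ (w 1) (w 0), φ (w 3) y, φ (w 3) (w 4)] : List (Fin n)).Nodup

def bridgeVerts {n : ℕ} (y z : Fin n) (w : Fin 6 → Fin n) : Finset (Fin n) :=
  insert y (insert z (Finset.image w Finset.univ))

def bridgeHasColour {n : ℕ} (φ : Fin n → Fin n → Fin n) (y z : Fin n)
    (w : Fin 6 → Fin n) (d : Fin n) : Prop :=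
  d = φ y (w 0) ∨ d = φ (w 1) (w 0) ∨ d = φ (w 1) (w 2) ∨ d = φ z (w 2) ∨
  d = φ (w 3) y ∨ d = φ (w 3) (w 4) ∨ d = φ (w 5) (w 4) ∨ d = φ (w 5) z

def WellSpreadBridgeGadgets {n : ℕ} (φ : Fin n → Fin n → Fin n) (y z : Fin n)
    (ℬ : Finset (Fin 6 → Fin n)) : Prop :=
  (∀ u : Fin n, u ≠ y → u ≠ z → (ℬ.filter fun w => u ∈ bridgeVerts y z w).card ≤ n) ∧
  (∀ d : Fin n, (ℬ.filter fun w => bridgeHasColour φ y z w d).card ≤ n)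


/-- The number of loops of colour `c`. -/
def loopCount {n : ℕ} (φ : Fin n → Fin n → Fin n) (c : Fin n) : ℕ :=
  Nat.card {i : Fin n // φ i i = c}

/-- For all `v, c`, a well-spread collection of at least `n²/2¹⁰⁰` `(v,c)`-absorbing
gadgets exists. -/
def HasAbsGadgets {n : ℕ} (φ : Fin n → Fin n → Fin n) : Prop :=
  ∀ v c : Fin n, ∃ 𝒜 : Finset (Fin 6 → Fin n),
    (∀ x ∈ 𝒜, IsAbsGadget φ v c x) ∧ WellSpreadAbsGadgets φ v c 𝒜 ∧
    (n : ℝ) ^ 2 / 2 ^ 100 ≤ 𝒜.card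

/-- For all distinct `y, z`, a well-spread collection of at least `n²/10⁵⁰`
`(y,z)`-bridging gadgets exists. -/
def HasBridgeGadgets {n : ℕ} (φ : Fin n → Fin n → Fin n) : Prop :=
  ∀ y z : Fin n, y ≠ z → ∃ ℬ : Finset (Fin 6 → Fin n),
    (∀ w ∈ ℬ, IsBridgeGadget φ y z w) ∧ WellSpreadBridgeGadgets φ y z ℬ ∧
    (n : ℝ) ^ 2 / 10 ^ 50 ≤ ℬ.card

/-! ### `(y,z,𝒫)`-bridges in `𝒢_D` -/

/-- `(D₁, …, D₆)` is an equitable ordered partition of `D` into six parts. -/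
def IsEquitableSixPartition {n : ℕ} (D : Finset (Fin n)) (P : Fin 6 → Finset (Fin n)) :
    Prop :=
  (∀ i, P i ⊆ D) ∧ (∀ i j, i ≠ j → Disjoint (P i) (P j)) ∧
  (Finset.univ.biUnion P = D) ∧ (∀ i j, (P i).card ≤ (P j).card + 1)

/-- A `(y,z,𝒫)`-bridge in `H ∈ 𝒢_D`. -/
def IsBridge {n : ℕ} {D : Finset (Fin n)} (H : GD n D) (y z : Fin n)
    (P : Fin 6 → Finset (Fin n)) (w : Fin 6 → Fin n) : Prop :=
  ([y, z, w 0, w 1, w 2, w 3, w 4, w 5] : List (Fin n)).Nodup ∧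
  ∃ d₁ d₂ d₃ d₄ d₅ d₆ : {d : Fin n // d ∈ D},
    (d₁ : Fin n) ∈ P 0 ∧ (d₂ : Fin n) ∈ P 1 ∧ (d₃ : Fin n) ∈ P 2 ∧
    (d₄ : Fin n) ∈ P 3 ∧ (d₅ : Fin n) ∈ P 4 ∧ (d₆ : Fin n) ∈ P 5 ∧
    H.1 d₁ y = w 0 ∧ H.1 d₁ (w 5) = w 4 ∧
    H.1 d₂ (w 1) = w 0 ∧ H.1 d₂ (w 5) = z ∧
    H.1 d₃ (w 3) = y ∧ H.1 d₃ (w 1) = w 2 ∧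
    H.1 d₄ (w 3) = w 4 ∧ H.1 d₄ z = w 2 ∧
    H.1 d₅ y = w 1 ∧ H.1 d₆ z = w 4

/-- The ten arcs of a `(y,z,𝒫)`-bridge. -/
def bridgeArcsOf {n : ℕ} (y z : Fin n) (w : Fin 6 → Fin n) : Finset (Fin n × Fin n) :=
  {(y, w 0), (w 1, w 0), (w 1, w 2), (z, w 2), (w 3, y), (w 3, w 4), (w 5, w 4), (w 5, z),
   (y, w 1), (z, w 4)}

/-- The four arcs `w₂→w₁, w₂→w₃, w₄→w₅, w₆→w₅` of a bridge. -/
def keyArcsOf {n : ℕ} (w : Fin 6 → Fin n) : Finset (Fin n × Fin n) :=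
  {(w 1, w 0), (w 1, w 2), (w 3, w 4), (w 5, w 4)}

/-- A distinguishable `(y,z,𝒫)`-bridge: the only bridge containing any of its four key arcs. -/
def IsDistinguishableBridge {n : ℕ} {D : Finset (Fin n)} (H : GD n D) (y z : Fin n)
    (P : Fin 6 → Finset (Fin n)) (w : Fin 6 → Fin n) : Prop :=
  IsBridge H y z P w ∧
  ∀ w' : Fin 6 → Fin n, IsBridge H y z P w' →
    ¬ Disjoint (keyArcsOf w) (bridgeArcsOf y z w') → w' = w

/-- `r_{(y,z,𝒫)}(H)`: the number of distinguishable `(y,z,𝒫)`-bridges in `H`. -/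
def distBridgeCount {n : ℕ} {D : Finset (Fin n)} (H : GD n D) (y z : Fin n)
    (P : Fin 6 → Finset (Fin n)) : ℕ :=
  Nat.card {w : Fin 6 → Fin n // IsDistinguishableBridge H y z P w}

/-- Membership in `Q̂_D^{(y,z,𝒫)} = ⋃_{s=0}^{n|D|} M_s^{(y,z,𝒫)}`. -/
def InQhat {n : ℕ} {D : Finset (Fin n)} (H : GD n D) (y z : Fin n)
    (P : Fin 6 → Finset (Fin n)) : Prop :=
  distBridgeCount H y z P ≤ n * D.card ∧
  ∀ A₁ A₂ : Finset (Fin n), A₁.card = D.card → A₂.card = D.card →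
    (eArcs H A₁ A₂ : ℝ) ≤ 2 * (D.card : ℝ) ^ 3 / n + 12 * distBridgeCount H y z P

/-- A `(y,z)`-bridging gadget of `H ∈ 𝒢_D`. -/
def IsBridgeGadgetGD {n : ℕ} {D : Finset (Fin n)} (H : GD n D) (y z : Fin n)
    (w : Fin 6 → Fin n) : Prop :=
  ([y, z, w 0, w 1, w 2, w 3, w 4, w 5] : List (Fin n)).Nodup ∧
  ∃ d₁ d₂ d₃ d₄ : {d : Fin n // d ∈ D},
    ([(d₁ : Fin n), (d₂ : Fin n), (d₃ : Fin n), (d₄ : Fin n)] : List (Fin n)).Nodup ∧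
    H.1 d₁ y = w 0 ∧ H.1 d₁ (w 5) = w 4 ∧
    H.1 d₂ (w 1) = w 0 ∧ H.1 d₂ (w 5) = z ∧
    H.1 d₃ (w 3) = y ∧ H.1 d₃ (w 1) = w 2 ∧
    H.1 d₄ (w 3) = w 4 ∧ H.1 d₄ z = w 2

/-- The gadget (in `H ∈ 𝒢_D`) contains an arc of colour `d`. -/
def bridgeGadgetGDHasColour {n : ℕ} {D : Finset (Fin n)} (H : GD n D) (y z : Fin n)
    (w : Fin 6 → Fin n) (d : Fin n) : Prop :=
  ∃ d' : {d : Fin n // d ∈ D}, (d' : Fin n) = d ∧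
    (H.1 d' y = w 0 ∨ H.1 d' (w 1) = w 0 ∨ H.1 d' (w 1) = w 2 ∨ H.1 d' z = w 2 ∨
     H.1 d' (w 3) = y ∨ H.1 d' (w 3) = w 4 ∨ H.1 d' (w 5) = w 4 ∨ H.1 d' (w 5) = z)

def WellSpreadBridgeGadgetsGD {n : ℕ} {D : Finset (Fin n)} (H : GD n D) (y z : Fin n)
    (ℬ : Finset (Fin 6 → Fin n)) : Prop :=
  (∀ u : Fin n, u ≠ y → u ≠ z → (ℬ.filter fun w => u ∈ bridgeVerts y z w).card ≤ n) ∧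
  (∀ d : Fin n, (ℬ.filter fun w => bridgeGadgetGDHasColour H y z w d).card ≤ n)

/-! ### Directed paths, absorbers, `T`-absorbers -/

/-- The arcs of the directed path whose vertices are the entries of `p`, in order. -/
def pathArcs {n : ℕ} (p : List (Fin n)) : List (Fin n × Fin n) := p.zip p.tail

def pathColours {n : ℕ} (φ : Fin n → Fin n → Fin n) (p : List (Fin n)) : List (Fin n) :=
  (pathArcs p).map fun e => φ e.1 e.2

def internalVerts {n : ℕ} (p : List (Fin n)) : List (Fin n) := (p.drop 1).dropLast

set_option maxHeartbeats 1600000 in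
/-- A `(v,c)`-absorber: a `(v,c)`-absorbing gadget with vertices `x`, bridged by an
`(x₄,x₅)`-bridging gadget with vertices `w`, completed by four rainbow directed paths. -/
structure Absorber (n : ℕ) (φ : Fin n → Fin n → Fin n) (v c : Fin n) where
  x : Fin 6 → Fin n
  w : Fin 6 → Fin n
  P : Fin 4 → List (Fin n)
  gadget : IsAbsGadget φ v c x
  bridge : IsBridgeGadget φ (x 3) (x 4) w
  meetAB : absGadgetVerts v x ∩ bridgeVerts (x 3) (x 4) w = {x 3, x 4}
  colourDisjointAB :
    ∀ d : Fin n, absGadgetHasColour φ v x d → bridgeHasColour φ (x 3) (x 4) w d → False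
  pathNodup : ∀ i, (P i).Nodup
  pathEnds :
    (P 0).head? = some (x 1) ∧ (P 0).getLast? = some (x 2) ∧
    (P 1).head? = some (w 0) ∧ (P 1).getLast? = some (w 3) ∧
    (P 2).head? = some (w 4) ∧ (P 2).getLast? = some (w 1) ∧
    (P 3).head? = some (w 2) ∧ (P 3).getLast? = some (w 5)
  pathsDisjoint : ∀ i j, i ≠ j → ∀ a ∈ P i, a ∉ P j
  pathInternalDisjoint : ∀ i, ∀ a ∈ internalVerts (P i),
    a ∉ absGadgetVerts v x ∧ a ∉ bridgeVerts (x 3) (x 4) w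
  pathsRainbowEach : ∀ i, (pathColours φ (P i)).Nodup
  pathsRainbowPair : ∀ i j, i ≠ j → ∀ d ∈ pathColours φ (P i), d ∉ pathColours φ (P j)
  pathColoursNew : ∀ i, ∀ d ∈ pathColours φ (P i),
    ¬ absGadgetHasColour φ v x d ∧ ¬ bridgeHasColour φ (x 3) (x 4) w d

def Absorber.arcs {n : ℕ} {φ : Fin n → Fin n → Fin n} {v c : Fin n}
    (A : Absorber n φ v c) : Finset (Fin n × Fin n) :=
  ({(A.x 0, v), (v, A.x 1), (A.x 0, A.x 1), (A.x 2, A.x 3), (A.x 2, A.x 4),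
    (A.x 3, A.x 5), (A.x 4, A.x 5)} : Finset (Fin n × Fin n)) ∪
  ({(A.x 3, A.w 0), (A.w 1, A.w 0), (A.w 1, A.w 2), (A.x 4, A.w 2), (A.w 3, A.x 3),
    (A.w 3, A.w 4), (A.w 5, A.w 4), (A.w 5, A.x 4)} : Finset (Fin n × Fin n)) ∪
  Finset.univ.biUnion fun i : Fin 4 => (pathArcs (A.P i)).toFinset

def Absorber.verts {n : ℕ} {φ : Fin n → Fin n → Fin n} {v c : Fin n}
    (A : Absorber n φ v c) : Finset (Fin n) :=
  absGadgetVerts v A.x ∪ bridgeVerts (A.x 3) (A.x 4) A.w ∪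
    Finset.univ.biUnion fun i : Fin 4 => (A.P i).toFinset

def Absorber.colours {n : ℕ} {φ : Fin n → Fin n → Fin n} {v c : Fin n}
    (A : Absorber n φ v c) : Finset (Fin n) :=
  A.arcs.image fun e => φ e.1 e.2

def Absorber.initial {n : ℕ} {φ : Fin n → Fin n → Fin n} {v c : Fin n}
    (A : Absorber n φ v c) : Fin n := A.x 0

def Absorber.terminal {n : ℕ} {φ : Fin n → Fin n → Fin n} {v c : Fin n}
    (A : Absorber n φ v c) : Fin n := A.x 5

/-- A `T`-absorber inside the coloured `K_n^↔`, with arc set `H`. -/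
structure TAbsorber (n : ℕ) (φ : Fin n → Fin n → Fin n) {α β : Type}
    [Fintype α] [Fintype β] [DecidableEq α] [DecidableEq β]
    (T : Finset (α × β)) (H : Finset (Fin n × Fin n)) where
  fV : α → Fin n
  fC : β → Fin n
  fVinj : Function.Injective fV
  fCinj : Function.Injective fC
  fCrange : ∀ b : β, fC b ∈ H.image fun e : Fin n × Fin n => φ e.1 e.2
  Ab : (e : α × β) → e ∈ T → Absorber n φ (fV e.1) (fC e.2)
  AbSub : ∀ e he, (Ab e he).arcs ⊆ H
  AbUnique : ∀ e he (A' : Absorber n φ (fV e.1) (fC e.2)),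
    A'.arcs ⊆ H → A'.arcs = (Ab e he).arcs
  AbVertexDisjoint : ∀ e he e' he', e ≠ e' →
    ∀ u : Fin n, u ∈ (Ab e he).verts → u ∈ (Ab e' he').verts → e.1 = e'.1 ∧ u = fV e.1
  AbColourDisjoint : ∀ e he e' he', e ≠ e' →
    ∀ d : Fin n, d ∈ (Ab e he).colours → d ∈ (Ab e' he').colours → e.2 = e'.2 ∧ d = fC e.2
  es : Fin T.card → α × β
  esInj : Function.Injective es
  esMem : ∀ i, es i ∈ T
  link : Fin (T.card - 1) → List (Fin n)
  linkLen : ∀ i, (link i).length = 4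
  linkNodup : ∀ i, (link i).Nodup
  linkSub : ∀ i, ∀ e ∈ pathArcs (link i), e ∈ H
  linkPairwiseDisjoint : ∀ i j, i ≠ j → ∀ a ∈ link i, a ∉ link j
  linkRainbowEach : ∀ i, (pathColours φ (link i)).Nodup
  linkRainbowPair : ∀ i j, i ≠ j → ∀ d ∈ pathColours φ (link i), d ∉ pathColours φ (link j)
  linkColourNew : ∀ i, ∀ d ∈ pathColours φ (link i), ∀ e he, d ∉ (Ab e he).colours
  linkHead : ∀ i : Fin (T.card - 1),
    (link i).head? = some (Ab (es (Fin.castLE (Nat.sub_le _ _) i)) (esMem _)).terminal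
  linkLast : ∀ i : Fin (T.card - 1),
    (link i).getLast? =
      some (Ab (es ⟨i.1 + 1, by have := i.2; omega⟩) (esMem _)).initial
  linkInternalDisjoint : ∀ i, ∀ a ∈ internalVerts (link i), ∀ e he, a ∉ (Ab e he).verts
  minimal : H = (T.attach.biUnion fun e => (Ab e.1 e.2).arcs) ∪
      (Finset.univ.biUnion fun i => (pathArcs (link i)).toFinset)

def TAbsorber.initialVtx {n : ℕ} {φ : Fin n → Fin n → Fin n} {α β : Type}
    [Fintype α] [Fintype β] [DecidableEq α] [DecidableEq β]
    {T : Finset (α × β)} {H : Finset (Fin n × Fin n)} (𝔸 : TAbsorber n φ T H)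
    (h : 0 < T.card) : Fin n :=
  (𝔸.Ab (𝔸.es ⟨0, h⟩) (𝔸.esMem _)).initial

def TAbsorber.terminalVtx {n : ℕ} {φ : Fin n → Fin n → Fin n} {α β : Type}
    [Fintype α] [Fintype β] [DecidableEq α] [DecidableEq β]
    {T : Finset (α × β)} {H : Finset (Fin n × Fin n)} (𝔸 : TAbsorber n φ T H)
    (h : 0 < T.card) : Fin n :=
  (𝔸.Ab (𝔸.es ⟨T.card - 1, Nat.sub_lt h Nat.one_pos⟩) (𝔸.esMem _)).terminal

/-- `T` (bipartite, edge set a finset of `α × β`) is robustly matchable with respect to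
flexible sets `A'`, `B'`. -/
def RobustlyMatchable {α β : Type} [DecidableEq α] [DecidableEq β]
    (T : Finset (α × β)) (A' : Finset α) (B' : Finset β) : Prop :=
  ∀ X : Finset α, ∀ Y : Finset β, X ⊆ A' → Y ⊆ B' → X.card = Y.card →
    (X.card : ℝ) ≤ min ((A'.card : ℝ) / 2) ((B'.card : ℝ) / 2) →
    ∃ M : Finset (α × β), M ⊆ T ∧ (∀ e ∈ M, e.1 ∉ X ∧ e.2 ∉ Y) ∧
      (∀ a : α, a ∉ X → ∃! e, e ∈ M ∧ e.1 = a) ∧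
      (∀ b : β, b ∉ Y → ∃! e, e ∈ M ∧ e.2 = b)

def arcVerts {n : ℕ} (H : Finset (Fin n × Fin n)) : Finset (Fin n) :=
  H.image Prod.fst ∪ H.image Prod.snd

/-- `H` (an arc set in the coloured `K_n^↔`) is robustly rainbow-Hamiltonian with respect
to flexible sets `Vf`, `Cf` and initial and terminal vertices `u`, `v`. -/
def RobustlyRainbowHam {n : ℕ} (φ : Fin n → Fin n → Fin n) (H : Finset (Fin n × Fin n))
    (Vf Cf : Finset (Fin n)) (u v : Fin n) : Prop :=
  ∀ X Y : Finset (Fin n), X ⊆ Vf → Y ⊆ Cf → X.card = Y.card →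
    (X.card : ℝ) ≤ min ((Vf.card : ℝ) / 2) ((Cf.card : ℝ) / 2) →
    ∃ p : List (Fin n), p.Nodup ∧ p.head? = some u ∧ p.getLast? = some v ∧
      (∀ e ∈ pathArcs p, e ∈ H) ∧
      (∀ a ∈ p, a ∉ X) ∧
      p.toFinset = arcVerts H \ X ∧
      (pathColours φ p).Nodup ∧
      (∀ d ∈ pathColours φ p, d ∉ Y)

/-! ### Lower-quasirandomness and rainbow directed path forests -/

/-- `e_{G,D}(U₁,U₂)`: the number of arcs with tail in `U₁`, head in `U₂`, colour in `D`. -/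
def colArcCount {n : ℕ} (φ : Fin n → Fin n → Fin n) (U₁ U₂ D : Finset (Fin n)) : ℕ :=
  Nat.card {p : Fin n × Fin n // p.1 ∈ U₁ ∧ p.2 ∈ U₂ ∧ φ p.1 p.2 ∈ D}

def LowerQuasirandom {n : ℕ} (φ : Fin n → Fin n → Fin n) : Prop :=
  ∀ U₁ U₂ D : Finset (Fin n),
    (U₁.card : ℝ) * U₂.card * D.card / n - (n : ℝ) ^ (5 / 3 : ℝ) ≤ colArcCount φ U₁ U₂ D

/-- The arc set `Q` contains a directed cycle (a loop counts as a cycle of length one). -/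
def HasDiCycle {n : ℕ} (Q : Finset (Fin n × Fin n)) : Prop :=
  ∃ (a : Fin n) (l : List (Fin n)), (a :: l).Nodup ∧
    List.Chain (fun u v : Fin n => (u, v) ∈ Q) a l ∧
    ((a :: l).getLast (List.cons_ne_nil a l), a) ∈ Q

/-- `Q` is (the arc set of) a spanning rainbow directed path forest of `G − U`, using no
colour of `D`, with at most `n^{9/10}` components. -/
def IsGoodPathForest {n : ℕ} (φ : Fin n → Fin n → Fin n) (U D : Finset (Fin n))
    (Q : Finset (Fin n × Fin n)) : Prop :=
  (∀ e ∈ Q, e.1 ∉ U ∧ e.2 ∉ U) ∧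
  (∀ e ∈ Q, ∀ e' ∈ Q, e ≠ e' → e.1 ≠ e'.1 ∧ e.2 ≠ e'.2) ∧
  ¬ HasDiCycle Q ∧
  Set.InjOn (fun e : Fin n × Fin n => φ e.1 e.2) (Q : Set (Fin n × Fin n)) ∧
  (∀ e ∈ Q, φ e.1 e.2 ∉ D) ∧
  ((n : ℝ) - U.card - Q.card ≤ (n : ℝ) ^ (9 / 10 : ℝ))


/-! ### Distinguishable bridges form a well-spread collection of gadgets -/

section DistinguishableBridges

variable {n : ℕ} {D : Finset (Fin n)} {H : GD n D} {y z : Fin n}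
  {P : Fin 6 → Finset (Fin n)} {w w' : Fin 6 → Fin n}

lemma GD.colour_unique (H : GD n D) {d d' : {d : Fin n // d ∈ D}} {i j : Fin n}
    (h : H.1 d i = j) (h' : H.1 d' i = j) : d = d' :=
  H.2.2 i (h.trans h'.symm)

lemma GD.tail_unique (H : GD n D) {d : {d : Fin n // d ∈ D}} {i i' j : Fin n}
    (h : H.1 d i = j) (h' : H.1 d i' = j) : i = i' :=
  (H.2.1 d).injective (h.trans h'.symm)

/-- Six times the size of a part of an equitable six-partition is at most `|D| + 5`. -/
lemma IsEquitableSixPartition.six_mul_card_le (hP : IsEquitableSixPartition D P) (i : Fin 6) :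
    6 * (P i).card ≤ D.card + 5 := by
  obtain ⟨-, hdisj, hunion, hcard⟩ := hP
  have hsum : D.card = ∑ j, (P j).card := by
    rw [← hunion]
    exact Finset.card_biUnion fun i _ j _ hij => hdisj i j hij
  rw [Fin.sum_univ_six] at hsum
  have := hcard i
  have h0 := this 0
  have h1 := this 1
  have h2 := this 2
  have h3 := this 3
  have h4 := this 4
  have h5 := this 5
  fin_cases i <;> simp only [Fin.reduceFinMk, Fin.isValue, Fin.zero_eta, Fin.mk_one] at * <;>
    omega

lemma IsBridge.isBridgeGadgetGD (hP : IsEquitableSixPartition D P) (h : IsBridge H y z P w) :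
    IsBridgeGadgetGD H y z w := by
  obtain ⟨hw, d₁, d₂, d₃, d₄, d₅, d₆, h₁, h₂, h₃, h₄, -, -, e₁, e₂, e₃, e₄, e₅, e₆, e₇, e₈, -⟩ := h
  have hne : ∀ {i j : Fin 6} {a b : Fin n}, i ≠ j → a ∈ P i → b ∈ P j → a ≠ b :=
    fun hij ha hb => Finset.disjoint_left.mp (hP.2.1 _ _ hij) ha |> fun h e => h (e ▸ hb)
  refine ⟨hw, d₁, d₂, d₃, d₄, ?_, e₁, e₂, e₃, e₄, e₅, e₆, e₇, e₈⟩
  simp only [List.nodup_cons, List.mem_cons, List.not_mem_nil, or_false, not_or,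
    not_false_eq_true, List.nodup_nil, and_true]
  exact ⟨⟨hne (by decide) h₁ h₂, hne (by decide) h₁ h₃, hne (by decide) h₁ h₄⟩,
    ⟨hne (by decide) h₂ h₃, hne (by decide) h₂ h₄⟩, hne (by decide) h₃ h₄⟩

lemma IsDistinguishableBridge.eq_of_mem (h : IsDistinguishableBridge H y z P w)
    (h' : IsDistinguishableBridge H y z P w') {e : Fin n × Fin n}
    (he : e ∈ keyArcsOf w) (he' : e ∈ bridgeArcsOf y z w') : w = w' :=
  (h.2 w' h'.1 (Finset.not_disjoint_iff.mpr ⟨e, he, he'⟩)).symm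

lemma IsDistinguishableBridge.eq_of_zero_one (h : IsDistinguishableBridge H y z P w)
    (h' : IsDistinguishableBridge H y z P w') (h₀ : w 0 = w' 0) (h₁ : w 1 = w' 1) : w = w' :=
  h.eq_of_mem h' (e := (w 1, w 0)) (by simp [keyArcsOf]) (by simp [bridgeArcsOf, h₀, h₁])

lemma IsDistinguishableBridge.eq_of_one_two (h : IsDistinguishableBridge H y z P w)
    (h' : IsDistinguishableBridge H y z P w') (h₁ : w 1 = w' 1) (h₂ : w 2 = w' 2) : w = w' :=
  h.eq_of_mem h' (e := (w 1, w 2)) (by simp [keyArcsOf]) (by simp [bridgeArcsOf, h₁, h₂])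

lemma IsDistinguishableBridge.eq_of_three_four (h : IsDistinguishableBridge H y z P w)
    (h' : IsDistinguishableBridge H y z P w') (h₃ : w 3 = w' 3) (h₄ : w 4 = w' 4) : w = w' :=
  h.eq_of_mem h' (e := (w 3, w 4)) (by simp [keyArcsOf]) (by simp [bridgeArcsOf, h₃, h₄])

lemma IsDistinguishableBridge.eq_of_four_five (h : IsDistinguishableBridge H y z P w)
    (h' : IsDistinguishableBridge H y z P w') (h₄ : w 4 = w' 4) (h₅ : w 5 = w' 5) : w = w' :=
  h.eq_of_mem h' (e := (w 5, w 4)) (by simp [keyArcsOf]) (by simp [bridgeArcsOf, h₄, h₅])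

/-- The finset of distinguishable `(y,z,𝒫)`-bridges of `H`. -/
def distBridges (H : GD n D) (y z : Fin n) (P : Fin 6 → Finset (Fin n)) :
    Finset (Fin 6 → Fin n) :=
  Finset.univ.filter fun w => IsDistinguishableBridge H y z P w

lemma mem_distBridges : w ∈ distBridges H y z P ↔ IsDistinguishableBridge H y z P w := by
  simp [distBridges]

lemma card_distBridges : (distBridges H y z P).card = distBridgeCount H y z P := by
  rw [distBridgeCount, Nat.card_eq_fintype_card, Fintype.card_subtype, distBridges]

/-- For each `i` there is a part of the partition bounding the number of distinguishable
bridges whose `i`-th vertex is prescribed. -/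
lemma exists_card_filter_apply_eq_le (H : GD n D) (y z : Fin n)
    (P : Fin 6 → Finset (Fin n)) (i : Fin 6) (u : Fin n) :
    ∃ j, ((distBridges H y z P).filter fun w => w i = u).card ≤ (P j).card := by
  have key : ∀ (j : Fin 6) (R : (Fin 6 → Fin n) → {d : Fin n // d ∈ D} → Prop),
      (∀ w, IsDistinguishableBridge H y z P w → w i = u →
        ∃ d : {d : Fin n // d ∈ D}, (d : Fin n) ∈ P j ∧ R w d) →
      (∀ d w w', IsDistinguishableBridge H y z P w → w i = u →
        IsDistinguishableBridge H y z P w' → w' i = u → R w d → R w' d → w = w') →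
      ∃ j, ((distBridges H y z P).filter fun w => w i = u).card ≤ (P j).card := by
    intro j R hex huniq
    refine ⟨j, Finset.card_le_card_of_forall_subsingleton
      (fun w d => ∃ h : d ∈ D, R w ⟨d, h⟩) ?_ ?_⟩
    · intro w hw
      rw [Finset.mem_filter, mem_distBridges] at hw
      obtain ⟨d, hd, hR⟩ := hex w hw.1 hw.2
      exact ⟨d, hd, d.2, hR⟩
    · rintro d - w ⟨hw, hd, hR⟩ w' ⟨hw', _, hR'⟩
      rw [Finset.mem_filter, mem_distBridges] at hw hw'
      exact huniq ⟨d, hd⟩ w w' hw.1 hw.2 hw'.1 hw'.2 hR hR'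
  have hy : ∀ w, IsDistinguishableBridge H y z P w →
      ∃ d : {d : Fin n // d ∈ D}, (d : Fin n) ∈ P 4 ∧ H.1 d y = w 1 := by
    rintro w ⟨⟨-, d₁, d₂, d₃, d₄, d₅, d₆, -, -, -, -, h₅, -, -, -, -, -, -, -, -, -, e, -⟩, -⟩
    exact ⟨d₅, h₅, e⟩
  have hz : ∀ w, IsDistinguishableBridge H y z P w →
      ∃ d : {d : Fin n // d ∈ D}, (d : Fin n) ∈ P 5 ∧ H.1 d z = w 4 := by
    rintro w ⟨⟨-, d₁, d₂, d₃, d₄, d₅, d₆, -, -, -, -, -, h₆, -, -, -, -, -, -, -, -, -, e⟩, -⟩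
    exact ⟨d₆, h₆, e⟩
  have h10 : ∀ w, IsDistinguishableBridge H y z P w →
      ∃ d : {d : Fin n // d ∈ D}, (d : Fin n) ∈ P 1 ∧ H.1 d (w 1) = w 0 := by
    rintro w ⟨⟨-, d₁, d₂, d₃, d₄, d₅, d₆, -, h₂, -, -, -, -, -, -, e, -⟩, -⟩
    exact ⟨d₂, h₂, e⟩
  have h34 : ∀ w, IsDistinguishableBridge H y z P w →
      ∃ d : {d : Fin n // d ∈ D}, (d : Fin n) ∈ P 3 ∧ H.1 d (w 3) = w 4 := by
    rintro w ⟨⟨-, d₁, d₂, d₃, d₄, d₅, d₆, -, -, -, h₄, -, -, -, -, -, -, -, -, e, -⟩, -⟩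
    exact ⟨d₄, h₄, e⟩
  fin_cases i
  · exact key 4 (fun w d => H.1 d y = w 1) (fun w hw _ => hy w hw)
      fun d w w' hw hi hw' hi' e e' => hw.eq_of_zero_one hw' (hi.trans hi'.symm) (e.symm.trans e')
  · exact key 1 (fun w d => H.1 d (w 1) = w 0) (fun w hw _ => h10 w hw)
      fun d w w' hw hi hw' hi' e e' => hw.eq_of_zero_one hw'
        (e.symm.trans ((congrArg (H.1 d) (hi.trans hi'.symm)).trans e')) (hi.trans hi'.symm)
  · exact key 4 (fun w d => H.1 d y = w 1) (fun w hw _ => hy w hw)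
      fun d w w' hw hi hw' hi' e e' => hw.eq_of_one_two hw' (e.symm.trans e') (hi.trans hi'.symm)
  · exact key 5 (fun w d => H.1 d z = w 4) (fun w hw _ => hz w hw)
      fun d w w' hw hi hw' hi' e e' => hw.eq_of_three_four hw' (hi.trans hi'.symm) (e.symm.trans e')
  · exact key 3 (fun w d => H.1 d (w 3) = w 4) (fun w hw _ => h34 w hw)
      fun d w w' hw hi hw' hi' e e' => hw.eq_of_three_four hw'
        (H.tail_unique (e.trans hi) (e'.trans hi')) (hi.trans hi'.symm)
  · exact key 5 (fun w d => H.1 d z = w 4) (fun w hw _ => hz w hw)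
      fun d w w' hw hi hw' hi' e e' => hw.eq_of_four_five hw' (e.symm.trans e') (hi.trans hi'.symm)

lemma filter_mem_bridgeVerts_subset {u : Fin n} (hy : u ≠ y) (hz : u ≠ z)
    (ℬ : Finset (Fin 6 → Fin n)) :
    (ℬ.filter fun w => u ∈ bridgeVerts y z w) ⊆
      Finset.univ.biUnion fun i : Fin 6 => ℬ.filter fun w => w i = u := by
  intro w hw
  simp only [bridgeVerts, Finset.mem_filter, Finset.mem_insert, Finset.mem_image,
    Finset.mem_univ, true_and, hy, hz, false_or] at hw
  simpa [hw.1] using hw.2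

/-- A bridge with an arc of colour `d` has one of its vertices `w₁, w₃, w₄, w₆` at the other
end of an arc of colour `d` at `y` or `z`. -/
lemma IsBridge.apply_eq_of_hasColour (h : IsBridge H y z P w) {d : Fin n}
    (hd : bridgeGadgetGDHasColour H y z w d) :
    ∃ h : d ∈ D, H.1 ⟨d, h⟩ y = w 0 ∨ H.1 ⟨d, h⟩ z = w 2 ∨
      H.1 ⟨d, h⟩ (w 3) = y ∨ H.1 ⟨d, h⟩ (w 5) = z := by
  obtain ⟨-, d₁, d₂, d₃, d₄, -, -, -, -, -, -, -, -, e₁, e₂, e₃, e₄, e₅, e₆, e₇, e₈, -⟩ := h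
  obtain ⟨d', rfl, hd⟩ := hd
  refine ⟨d'.2, ?_⟩
  rcases hd with h | h | h | h | h | h | h | h
  · exact Or.inl h
  · exact Or.inr (Or.inr (Or.inr (H.colour_unique h e₃ ▸ e₄)))
  · exact Or.inr (Or.inr (Or.inl (H.colour_unique h e₆ ▸ e₅)))
  · exact Or.inr (Or.inl h)
  · exact Or.inr (Or.inr (Or.inl h))
  · exact Or.inr (Or.inl (H.colour_unique h e₇ ▸ e₈))
  · exact Or.inl (H.colour_unique h e₂ ▸ e₁)
  · exact Or.inr (Or.inr (Or.inr h))

/-- The distinguishable bridges containing an arc of colour `d` have a prescribed `i`-th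
vertex for some index `i`. -/
lemma exists_filter_hasColour_subset (H : GD n D) (y z : Fin n)
    (P : Fin 6 → Finset (Fin n)) (d : Fin n) :
    ∃ u : Fin 6 → Fin n,
      ((distBridges H y z P).filter fun w => bridgeGadgetGDHasColour H y z w d) ⊆
        Finset.univ.biUnion fun i : Fin 6 => (distBridges H y z P).filter fun w => w i = u i := by
  by_cases hd : d ∈ D
  · obtain ⟨a, ha⟩ := (H.2.1 ⟨d, hd⟩).surjective y
    obtain ⟨b, hb⟩ := (H.2.1 ⟨d, hd⟩).surjective z
    refine ⟨![H.1 ⟨d, hd⟩ y, y, H.1 ⟨d, hd⟩ z, a, y, b], fun w hw => ?_⟩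
    rw [Finset.mem_filter] at hw
    simp only [Finset.mem_biUnion, Finset.mem_univ, true_and, Finset.mem_filter, hw.1]
    obtain ⟨_, h | h | h | h⟩ := (mem_distBridges.mp hw.1).1.apply_eq_of_hasColour hw.2
    · exact ⟨0, h.symm⟩
    · exact ⟨2, h.symm⟩
    · exact ⟨3, H.tail_unique h ha⟩
    · exact ⟨5, H.tail_unique h hb⟩
  · refine ⟨fun _ => y, fun w hw => ?_⟩
    rw [Finset.mem_filter] at hw
    exact absurd ((mem_distBridges.mp hw.1).1.apply_eq_of_hasColour hw.2).1 hd

lemma card_biUnion_filter_apply_eq_le (hP : IsEquitableSixPartition D P)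
    (hD : D.card + 5 ≤ n) (H : GD n D) (y z : Fin n) (u : Fin 6 → Fin n) :
    (Finset.univ.biUnion fun i : Fin 6 =>
      (distBridges H y z P).filter fun w => w i = u i).card ≤ n := by
  have hle : ∀ i ∈ (Finset.univ : Finset (Fin 6)),
      ((distBridges H y z P).filter fun w => w i = u i).card ≤ n / 6 := by
    intro i _
    obtain ⟨j, hj⟩ := exists_card_filter_apply_eq_le H y z P i (u i)
    have := hP.six_mul_card_le j
    omega
  have := Finset.card_biUnion_le_card_mul _ _ _ hle
  rw [Finset.card_univ, Fintype.card_fin] at this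
  omega

lemma wellSpread_distBridges (hP : IsEquitableSixPartition D P) (hD : D.card + 5 ≤ n)
    (H : GD n D) (y z : Fin n) :
    WellSpreadBridgeGadgetsGD H y z (distBridges H y z P) := by
  refine ⟨fun u hy hz => ?_, fun d => ?_⟩
  · exact (Finset.card_le_card (filter_mem_bridgeVerts_subset hy hz _)).trans
      (card_biUnion_filter_apply_eq_le hP hD H y z fun _ => u)
  · obtain ⟨u, hu⟩ := exists_filter_hasColour_subset H y z P d
    exact (Finset.card_le_card hu).trans (card_biUnion_filter_apply_eq_le hP hD H y z u)

end DistinguishableBridges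

/-- For sufficiently large `n`, `|D| ≤ 3n/4`, an equitable
six-partition `𝒫` of `D`, and distinct `y, z`, every `H ∈ 𝒢_D` contains a well-spread
collection of `r_{(y,z,𝒫)}(H)` distinct `(y,z)`-bridging gadgets. -/
theorem statement_10 :
    ∃ n₀ : ℕ, ∀ n : ℕ, n₀ ≤ n →
      ∀ D : Finset (Fin n), (D.card : ℝ) ≤ 3 * n / 4 →
      ∀ P : Fin 6 → Finset (Fin n), IsEquitableSixPartition D P →
      ∀ y z : Fin n, y ≠ z → ∀ H : GD n D,
        ∃ ℬ : Finset (Fin 6 → Fin n),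
          (∀ w ∈ ℬ, IsBridgeGadgetGD H y z w) ∧
          WellSpreadBridgeGadgetsGD H y z ℬ ∧
          ℬ.card = distBridgeCount H y z P := by
  refine ⟨20, fun n hn D hD P hP y z _ H => ⟨distBridges H y z P, fun w hw =>
    (mem_distBridges.mp hw).1.isBridgeGadgetGD hP, wellSpread_distBridges hP ?_ H y z,
    card_distBridges⟩⟩
  have hn' : (20 : ℝ) ≤ n := by exact_mod_cast hn
  have : (D.card : ℝ) + 5 ≤ n := by linarith
  exact_mod_cast this

end RandomLatin
end
end

section
/- Let G ∈ Φ(K_n^↔) with proper n-arc-colouring φ. Let T be a bipartite graph with bipartition (A, B), let H ⊆ G be a T-absorber with associated injections f_V : A → V(H) and f_C : B → φ(H), let u and v be the initial and terminal vertices of H, let A' ⊆ A and B' ⊆ B, and let V' = f_V(A') and C' = f_C(B'). If T is robustly matchable with respect to flexible sets A' and B', then H is robustly rainbow-Hamiltonian with respect to flexible sets V' and C' and initial and terminal vertices u and v. -/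
open scoped Classical

noncomputable section

namespace RandomLatin

lemma pathArcs_append {n : ℕ} {p q : List (Fin n)} {a b : Fin n}
    (hp : p.getLast? = some a) (hq : q.head? = some b) :
    pathArcs (p ++ q) = pathArcs p ++ (a, b) :: pathArcs q := by
  induction p with
  | nil => simp at hp
  | cons x p ih =>
    cases p with
    | nil =>
      cases q with
      | nil => simp at hq
      | cons y q => simp_all [pathArcs]
    | cons y p =>
      have := ih (by simpa using hp)
      simp_all [pathArcs]

lemma pathColours_append {n : ℕ} (φ : Fin n → Fin n → Fin n) {p q : List (Fin n)} {a b : Fin n}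
    (hp : p.getLast? = some a) (hq : q.head? = some b) :
    pathColours φ (p ++ q) = pathColours φ p ++ φ a b :: pathColours φ q := by
  simp [pathColours, pathArcs_append hp hq]

@[simp] lemma pathArcs_singleton {n : ℕ} (a : Fin n) : pathArcs [a] = [] := rfl

@[simp] lemma pathArcs_cons_cons {n : ℕ} (a b : Fin n) (l : List (Fin n)) :
    pathArcs (a :: b :: l) = (a, b) :: pathArcs (b :: l) := rfl

@[simp] lemma pathColours_singleton {n : ℕ} (φ : Fin n → Fin n → Fin n) (a : Fin n) :
    pathColours φ [a] = [] := rfl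

@[simp] lemma pathColours_cons_cons {n : ℕ} (φ : Fin n → Fin n → Fin n) (a b : Fin n)
    (l : List (Fin n)) :
    pathColours φ (a :: b :: l) = φ a b :: pathColours φ (b :: l) := rfl

lemma pathArcs_cons {n : ℕ} {q : List (Fin n)} (a : Fin n) {b : Fin n} (hq : q.head? = some b) :
    pathArcs (a :: q) = (a, b) :: pathArcs q :=
  pathArcs_append (p := [a]) rfl hq

lemma pathColours_cons {n : ℕ} (φ : Fin n → Fin n → Fin n) {q : List (Fin n)} (a : Fin n)
    {b : Fin n} (hq : q.head? = some b) :
    pathColours φ (a :: q) = φ a b :: pathColours φ q :=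
  pathColours_append φ (p := [a]) rfl hq

lemma mem_of_mem_pathArcs {n : ℕ} {p : List (Fin n)} {e : Fin n × Fin n} (he : e ∈ pathArcs p) :
    e.1 ∈ p ∧ e.2 ∈ p := by
  have := List.of_mem_zip (a := e.1) (b := e.2) he
  exact ⟨this.1, List.mem_of_mem_tail this.2⟩

lemma exists_mem_pathArcs {n : ℕ} {p : List (Fin n)} (hp : 2 ≤ p.length) {a : Fin n}
    (ha : a ∈ p) : ∃ e ∈ pathArcs p, a = e.1 ∨ a = e.2 := by
  induction p with
  | nil => simp at ha
  | cons x p ih =>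
    cases p with
    | nil => simp at hp
    | cons y p =>
      rw [pathArcs_cons_cons]
      rcases List.mem_cons.1 ha with rfl | ha
      · exact ⟨(a, y), by simp⟩
      · cases p with
        | nil => exact ⟨(x, y), by simp_all⟩
        | cons z p =>
          obtain ⟨e, he, h⟩ := ih (by simp) ha
          exact ⟨e, List.mem_cons_of_mem _ he, h⟩

lemma mem_internalVerts_or {n : ℕ} {p : List (Fin n)} {a b u : Fin n} (ha : p.head? = some a)
    (hb : p.getLast? = some b) (hu : u ∈ p) : u = a ∨ u = b ∨ u ∈ internalVerts p := by
  cases p with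
  | nil => simp at ha
  | cons x p =>
    have hx : x = a := by simpa using ha
    subst hx
    rcases List.mem_cons.1 hu with rfl | hu
    · exact Or.inl rfl
    rcases List.eq_nil_or_concat p with rfl | ⟨p', y, rfl⟩
    · simp at hu
    · have hy : y = b := by
        have : (x :: p' ++ [y]).getLast? = some y := List.getLast?_concat
        rw [List.concat_eq_append, ← List.cons_append, this] at hb
        simpa using hb
      subst hy
      rw [List.concat_eq_append, List.mem_append, List.mem_singleton] at hu
      rcases hu with hu | hu
      · exact Or.inr (Or.inr (by simpa [internalVerts] using hu))
      · exact Or.inr (Or.inl hu)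

lemma mem_of_head? {n : ℕ} {p : List (Fin n)} {a : Fin n} (h : p.head? = some a) : a ∈ p :=
  List.mem_of_mem_head? (Option.mem_def.2 h)

lemma mem_of_getLast? {n : ℕ} {p : List (Fin n)} {a : Fin n} (h : p.getLast? = some a) : a ∈ p :=
  List.mem_of_mem_getLast? (Option.mem_def.2 h)

lemma two_le_length {n : ℕ} {p : List (Fin n)} {a b : Fin n} (ha : p.head? = some a)
    (hb : p.getLast? = some b) (hab : a ≠ b) : 2 ≤ p.length := by
  rcases p with _ | ⟨x, _ | ⟨y, p⟩⟩
  · simp at ha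
  · simp at ha hb; exact absurd (ha.symm.trans hb) hab
  · simp

/-- Concatenation of vertex-disjoint, colour-disjoint rainbow paths along connecting paths with
three arcs. -/
lemma exists_chained_path {n N : ℕ} (φ : Fin n → Fin n → Fin n)
    (S : Fin N → List (Fin n)) (L : Fin (N - 1) → List (Fin n)) (s t : Fin N → Fin n)
    (hSh : ∀ i, (S i).head? = some (s i)) (hSl : ∀ i, (S i).getLast? = some (t i))
    (hSnd : ∀ i, (S i).Nodup) (hSd : ∀ i j, i ≠ j → ∀ a ∈ S i, a ∉ S j)
    (hSc : ∀ i, (pathColours φ (S i)).Nodup)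
    (hScd : ∀ i j, i ≠ j → ∀ d ∈ pathColours φ (S i), d ∉ pathColours φ (S j))
    (hLlen : ∀ i, (L i).length = 4) (hLnd : ∀ i, (L i).Nodup)
    (hLd : ∀ i j, i ≠ j → ∀ a ∈ L i, a ∉ L j)
    (hLc : ∀ i, (pathColours φ (L i)).Nodup)
    (hLcd : ∀ i j, i ≠ j → ∀ d ∈ pathColours φ (L i), d ∉ pathColours φ (L j))
    (hLS : ∀ i j, ∀ d ∈ pathColours φ (L i), d ∉ pathColours φ (S j))
    (hLh : ∀ i : Fin (N - 1), (L i).head? = some (t ⟨i, by omega⟩))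
    (hLl : ∀ i : Fin (N - 1), (L i).getLast? = some (s ⟨i + 1, by omega⟩))
    (hLi : ∀ i, ∀ a ∈ internalVerts (L i), ∀ j, a ∉ S j)
    (k : ℕ) (hk : k < N) :
    ∃ p : List (Fin n), p.Nodup ∧ p.head? = some (s ⟨0, by omega⟩) ∧
      p.getLast? = some (t ⟨k, hk⟩) ∧
      (∀ a, a ∈ p ↔ (∃ i : Fin N, i.1 ≤ k ∧ a ∈ S i) ∨ ∃ i : Fin (N - 1), i.1 < k ∧ a ∈ L i) ∧
      (∀ e, e ∈ pathArcs p ↔ (∃ i : Fin N, i.1 ≤ k ∧ e ∈ pathArcs (S i)) ∨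
        ∃ i : Fin (N - 1), i.1 < k ∧ e ∈ pathArcs (L i)) ∧
      (pathColours φ p).Nodup := by
  induction k with
  | zero =>
    have h0 : ∀ i : Fin N, i.1 ≤ 0 ↔ i = ⟨0, hk⟩ := fun i => by simp [Fin.ext_iff]
    exact ⟨S ⟨0, hk⟩, hSnd _, hSh _, hSl _, by simp [h0], by simp [h0], hSc _⟩
  | succ k ih =>
    obtain ⟨p, hnd, hh, hl, hmem, harcs, hcol⟩ := ih (by omega)
    have hkN : k < N - 1 := by omega
    obtain ⟨x, a, b, y, hL⟩ : ∃ x a b y, L ⟨k, hkN⟩ = [x, a, b, y] :=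
      List.length_eq_four.1 (hLlen _)
    have hx : x = t ⟨k, by omega⟩ := by have := hLh ⟨k, hkN⟩; rw [hL] at this; simpa using this
    have hy : y = s ⟨k + 1, hk⟩ := by have := hLl ⟨k, hkN⟩; rw [hL] at this; simpa using this
    have hq : (a :: b :: S ⟨k + 1, hk⟩).head? = some a := rfl
    have hsplit : ∀ i : Fin N, i.1 ≤ k + 1 ↔ i.1 ≤ k ∨ i = ⟨k + 1, hk⟩ := fun i => by
      rw [Fin.ext_iff]; simp; omega
    have hsplit' : ∀ i : Fin (N - 1), i.1 < k + 1 ↔ i.1 < k ∨ i = ⟨k, hkN⟩ := fun i => by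
      rw [Fin.ext_iff]; simp; omega
    have hA : pathArcs (p ++ a :: b :: S ⟨k + 1, hk⟩) =
        pathArcs p ++ (pathArcs (L ⟨k, hkN⟩) ++ pathArcs (S ⟨k + 1, hk⟩)) := by
      rw [pathArcs_append hl hq, pathArcs_cons_cons, pathArcs_cons b (hSh _), hL, hx, hy]
      simp
    have hcolp : ∀ d ∈ pathColours φ p, (∃ i : Fin N, i.1 ≤ k ∧ d ∈ pathColours φ (S i)) ∨
        ∃ i : Fin (N - 1), i.1 < k ∧ d ∈ pathColours φ (L i) := by
      intro d hd
      obtain ⟨e, he, rfl⟩ := List.mem_map.1 hd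
      rcases (harcs e).1 he with ⟨i, hi, h⟩ | ⟨i, hi, h⟩
      · exact Or.inl ⟨i, hi, List.mem_map.2 ⟨e, h, rfl⟩⟩
      · exact Or.inr ⟨i, hi, List.mem_map.2 ⟨e, h, rfl⟩⟩
    have hint : ∀ u, u = a ∨ u = b → u ∈ L ⟨k, hkN⟩ ∧ ∀ j, u ∉ S j := by
      intro u hu
      refine ⟨by rw [hL]; rcases hu with rfl | rfl <;> simp, hLi ⟨k, hkN⟩ u ?_⟩
      rw [hL]; rcases hu with rfl | rfl <;> simp [internalVerts]
    have hab : a ≠ b := by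
      have := hLnd ⟨k, hkN⟩; rw [hL] at this; simp at this; tauto
    have hxS : t ⟨k, by omega⟩ ∈ S ⟨k, by omega⟩ := mem_of_getLast? (hSl _)
    have hyS : s ⟨k + 1, hk⟩ ∈ S ⟨k + 1, hk⟩ := mem_of_head? (hSh _)
    have hLmem : ∀ u, u ∈ L ⟨k, hkN⟩ ↔ u = x ∨ u = a ∨ u = b ∨ u = y := by
      intro u; rw [hL]; simp
    have hLpS : ∀ i : Fin (N - 1), i.1 < k → ∀ u ∈ L i, u ∉ S ⟨k + 1, hk⟩ := by
      intro i hi u hu hS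
      rcases mem_internalVerts_or (hLh i) (hLl i) hu with h | h | h
      · have : u ∈ S ⟨i, by omega⟩ := h ▸ mem_of_getLast? (hSl _)
        exact hSd _ _ (by simp [Fin.ext_iff]; omega) u this hS
      · have : u ∈ S ⟨i + 1, by omega⟩ := h ▸ mem_of_head? (hSh _)
        exact hSd _ _ (by simp [Fin.ext_iff]; omega) u this hS
      · exact hLi i u h _ hS
    refine ⟨p ++ a :: b :: S ⟨k + 1, hk⟩, ?_, ?_, ?_, ?_, ?_, ?_⟩
    · rw [List.nodup_append']
      refine ⟨hnd, ?_, ?_⟩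
      · simp only [List.nodup_cons, List.mem_cons, not_or]
        exact ⟨⟨hab, (hint a (Or.inl rfl)).2 _⟩, (hint b (Or.inr rfl)).2 _, hSnd _⟩
      · intro u hu hu'
        have hu'' : (u = a ∨ u = b) ∨ u ∈ S ⟨k + 1, hk⟩ := by simpa [or_assoc] using hu'
        rcases (hmem u).1 hu with ⟨i, hi, h⟩ | ⟨i, hi, h⟩
        · rcases hu'' with h' | h'
          · exact (hint u h').2 _ h
          · exact hSd i _ (by simp [Fin.ext_iff]; omega) u h h'
        · rcases hu'' with h' | h'
          · exact hLd i _ (by simp [Fin.ext_iff]; omega) u h (hint u h').1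
          · exact hLpS i hi u h h'
    · rw [List.head?_append, hh]; rfl
    · have : S ⟨k + 1, hk⟩ ≠ [] := fun h => by simpa [h] using hSh ⟨k + 1, hk⟩
      rw [List.getLast?_append, List.getLast?_cons, List.getLast?_cons, hSl]; rfl
    · intro u
      have hxp : t ⟨k, by omega⟩ ∈ p := mem_of_getLast? hl
      simp only [hsplit, hsplit', or_and_right, exists_or, exists_eq_left, List.mem_append,
        List.mem_cons, hLmem]
      have key : ∀ P Q p B C D E F : Prop, (p ↔ P ∨ Q) → (C → p) → (F → B) →
          ((p ∨ D ∨ E ∨ B) ↔ ((P ∨ B) ∨ Q ∨ C ∨ D ∨ E ∨ F)) := by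
        clear * -
        grind
      exact key _ _ _ _ _ _ _ _ (hmem u) (fun h => h ▸ hx ▸ hxp) (fun h => h ▸ hy ▸ hyS)
    · intro e
      rw [hA]
      simp only [hsplit, hsplit', or_and_right, exists_or, exists_eq_left, List.mem_append, harcs]
      rw [or_comm (a := e ∈ pathArcs (L _)), or_or_or_comm]
    · have hC : pathColours φ (p ++ a :: b :: S ⟨k + 1, hk⟩) =
          pathColours φ p ++ (pathColours φ (L ⟨k, hkN⟩) ++ pathColours φ (S ⟨k + 1, hk⟩)) := by
        simp only [pathColours, hA, List.map_append]
      rw [hC, List.nodup_append', List.nodup_append']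
      refine ⟨hcol, ⟨hLc _, hSc _, fun d => hLS _ _ d⟩, fun d hd hd' => ?_⟩
      rw [List.mem_append] at hd'
      rcases hcolp d hd with ⟨i, hi, h⟩ | ⟨i, hi, h⟩ <;> rcases hd' with h' | h'
      · exact hLS _ _ d h' h
      · exact hScd i _ (by simp [Fin.ext_iff]; omega) d h h'
      · exact hLcd i _ (by simp [Fin.ext_iff]; omega) d h h'
      · exact hLS _ _ d h h'

namespace Absorber

variable {n : ℕ} {φ : Fin n → Fin n → Fin n} {v c : Fin n} (A : Absorber n φ v c)

lemma root_mem_verts : v ∈ A.verts := by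
  simp [Absorber.verts, absGadgetVerts]

lemma x_mem_verts (i : Fin 6) : A.x i ∈ A.verts := by
  simp [Absorber.verts, absGadgetVerts]

lemma initial_mem_verts : A.initial ∈ A.verts := A.x_mem_verts 0

lemma terminal_mem_verts : A.terminal ∈ A.verts := A.x_mem_verts 5

lemma rootColour_mem_colours : c ∈ A.colours := by
  exact Finset.mem_image.2 ⟨(A.x 4, A.x 5), by simp [Absorber.arcs], A.gadget.2.2.2.2.1⟩

lemma x_ne_root (i : Fin 6) : A.x i ≠ v := by
  have := A.gadget.1
  simp at this
  fin_cases i <;> simp <;> tauto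

lemma x_injective : Function.Injective A.x := by
  have := A.gadget.1
  intro i j hij
  fin_cases i <;> fin_cases j <;> simp_all [eq_comm]

lemma w_injective : Function.Injective A.w := by
  have := A.bridge.1
  intro i j hij
  fin_cases i <;> fin_cases j <;> simp_all [eq_comm]

lemma w_notMem_gadget (i : Fin 6) : A.w i ∉ absGadgetVerts v A.x := by
  intro h
  have hm : A.w i ∈ absGadgetVerts v A.x ∩ bridgeVerts (A.x 3) (A.x 4) A.w :=
    Finset.mem_inter.2 ⟨h, by simp [bridgeVerts]⟩
  rw [A.meetAB] at hm
  have := A.bridge.1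
  simp at this hm
  fin_cases i <;> simp at hm <;> grind

lemma notMem_gadget_of_mem_path {i : Fin 4} (hi : i ≠ 0) {a : Fin n} (ha : a ∈ A.P i) :
    a ∉ absGadgetVerts v A.x := by
  obtain ⟨-, -, h1, h1', h2, h2', h3, h3'⟩ := A.pathEnds
  have key : ∀ {s t : Fin 6}, (A.P i).head? = some (A.w s) → (A.P i).getLast? = some (A.w t) →
      a ∉ absGadgetVerts v A.x := by
    intro s t hs ht
    rcases mem_internalVerts_or hs ht ha with rfl | rfl | h
    · exact A.w_notMem_gadget _
    · exact A.w_notMem_gadget _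
    · exact (A.pathInternalDisjoint _ _ h).1
  fin_cases i
  · exact absurd rfl hi
  · exact key h1 h1'
  · exact key h2 h2'
  · exact key h3 h3'

lemma mem_gadget_iff {a : Fin n} : a ∈ absGadgetVerts v A.x ↔
    a = v ∨ a = A.x 0 ∨ a = A.x 1 ∨ a = A.x 2 ∨ a = A.x 3 ∨ a = A.x 4 ∨ a = A.x 5 := by
  simp [absGadgetVerts, Fin.exists_fin_succ, eq_comm]

lemma mem_path_separate {i : Fin 4} {a : Fin n} (ha : a ∈ A.P i) :
    a ≠ v ∧ a ≠ A.x 0 ∧ a ≠ A.x 3 ∧ a ≠ A.x 4 ∧ a ≠ A.x 5 := by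
  have hx := fun j k (h : A.x j = A.x k) => A.x_injective h
  have hv := A.x_ne_root
  by_cases hi : i = 0
  · subst hi
    rcases mem_internalVerts_or A.pathEnds.1 A.pathEnds.2.1 ha with rfl | rfl | h
    · exact ⟨hv _, fun h => by simpa using hx _ _ h, fun h => by simpa using hx _ _ h,
        fun h => by simpa using hx _ _ h, fun h => by simpa using hx _ _ h⟩
    · exact ⟨hv _, fun h => by simpa using hx _ _ h, fun h => by simpa using hx _ _ h,
        fun h => by simpa using hx _ _ h, fun h => by simpa using hx _ _ h⟩
    · have := (A.pathInternalDisjoint _ _ h).1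
      rw [mem_gadget_iff] at this
      tauto
  · have := A.notMem_gadget_of_mem_path hi ha
    rw [mem_gadget_iff] at this
    tauto

lemma mem_verts_iff {a : Fin n} : a ∈ A.verts ↔
    a = v ∨ a = A.x 0 ∨ a = A.x 3 ∨ a = A.x 4 ∨ a = A.x 5 ∨
      a ∈ A.P 0 ∨ a ∈ A.P 1 ∨ a ∈ A.P 2 ∨ a ∈ A.P 3 := by
  obtain ⟨h0, h0', h1, h1', h2, h2', h3, h3'⟩ := A.pathEnds
  have hw : a ∈ bridgeVerts (A.x 3) (A.x 4) A.w ↔ a = A.x 3 ∨ a = A.x 4 ∨ a = A.w 0 ∨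
      a = A.w 1 ∨ a = A.w 2 ∨ a = A.w 3 ∨ a = A.w 4 ∨ a = A.w 5 := by
    simp [bridgeVerts, Fin.exists_fin_succ, eq_comm]
  have hP : (∃ i, a ∈ A.P i) ↔ a ∈ A.P 0 ∨ a ∈ A.P 1 ∨ a ∈ A.P 2 ∨ a ∈ A.P 3 := by
    simp [Fin.exists_fin_succ]
  simp only [Absorber.verts, Finset.mem_union, mem_gadget_iff, hw, Finset.mem_biUnion,
    Finset.mem_univ, true_and, List.mem_toFinset, hP]
  have e0 := mem_of_head? h0
  have e0' := mem_of_getLast? h0'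
  have e1 := mem_of_head? h1
  have e1' := mem_of_getLast? h1'
  have e2 := mem_of_head? h2
  have e2' := mem_of_getLast? h2'
  have e3 := mem_of_head? h3
  have e3' := mem_of_getLast? h3'
  grind

lemma arcVerts_arcs : arcVerts A.arcs = A.verts := by
  obtain ⟨h0, h0', h1, h1', h2, h2', h3, h3'⟩ := A.pathEnds
  have hP : ∀ i, 2 ≤ (A.P i).length := by
    have hx := fun j k (h : A.x j = A.x k) => A.x_injective h
    have hw := fun j k (h : A.w j = A.w k) => A.w_injective h
    intro i
    fin_cases i
    · exact two_le_length h0 h0' fun h => by simpa using hx _ _ h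
    · exact two_le_length h1 h1' fun h => by simpa using hw _ _ h
    · exact two_le_length h2 h2' fun h => by simpa using hw _ _ h
    · exact two_le_length h3 h3' fun h => by simpa using hw _ _ h
  have harc : ∀ e ∈ A.arcs, e.1 ∈ A.verts ∧ e.2 ∈ A.verts := by
    intro e he
    have hx := A.x_mem_verts
    have hw : ∀ i, A.w i ∈ A.verts := fun i => by simp [Absorber.verts, bridgeVerts]
    have hv := A.root_mem_verts
    simp only [Absorber.arcs, Finset.mem_union, Finset.mem_insert, Finset.mem_singleton,
      Finset.mem_biUnion, Finset.mem_univ, true_and, List.mem_toFinset] at he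
    rcases he with ((rfl | rfl | rfl | rfl | rfl | rfl | rfl) |
      (rfl | rfl | rfl | rfl | rfl | rfl | rfl | rfl)) | ⟨i, h⟩
    all_goals first
      | exact ⟨hx _, hx _⟩ | exact ⟨hx _, hw _⟩ | exact ⟨hw _, hx _⟩ | exact ⟨hw _, hw _⟩
      | exact ⟨hv, hx _⟩ | exact ⟨hx _, hv⟩ | skip
    have hi : ∀ u ∈ A.P i, u ∈ A.verts := fun u hu =>
      Finset.mem_union_right _ (Finset.mem_biUnion.2 ⟨i, Finset.mem_univ _, by simpa using hu⟩)
    exact ⟨hi _ (mem_of_mem_pathArcs h).1, hi _ (mem_of_mem_pathArcs h).2⟩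
  ext a
  constructor
  · intro ha
    simp only [arcVerts, Finset.mem_union, Finset.mem_image] at ha
    rcases ha with ⟨e, he, rfl⟩ | ⟨e, he, rfl⟩
    · exact (harc e he).1
    · exact (harc e he).2
  · intro ha
    have key : ∃ e ∈ A.arcs, a = e.1 ∨ a = e.2 := by
      have hpath : ∀ i, a ∈ A.P i → ∃ e ∈ A.arcs, a = e.1 ∨ a = e.2 := by
        intro i hi
        obtain ⟨e, he, h⟩ := exists_mem_pathArcs (hP i) hi
        exact ⟨e, Finset.mem_union_right _ (Finset.mem_biUnion.2
          ⟨i, Finset.mem_univ _, by simpa using he⟩), h⟩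
      rcases A.mem_verts_iff.1 ha with rfl | rfl | rfl | rfl | rfl | h | h | h | h
      · exact ⟨(A.x 0, a), by simp [Absorber.arcs], Or.inr rfl⟩
      · exact ⟨(A.x 0, v), by simp [Absorber.arcs], Or.inl rfl⟩
      · exact ⟨(A.x 2, A.x 3), by simp [Absorber.arcs], Or.inr rfl⟩
      · exact ⟨(A.x 2, A.x 4), by simp [Absorber.arcs], Or.inr rfl⟩
      · exact ⟨(A.x 3, A.x 5), by simp [Absorber.arcs], Or.inr rfl⟩
      all_goals exact hpath _ h
    obtain ⟨e, he, h⟩ := key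
    simp only [arcVerts, Finset.mem_union, Finset.mem_image]
    exact h.imp (fun h => ⟨e, he, h.symm⟩) (fun h => ⟨e, he, h.symm⟩)

/-- The path through all vertices of the absorber, including its root. -/
def absorbingPath : List (Fin n) :=
  A.x 0 :: v :: (A.P 0 ++ (A.x 3 :: (A.P 1 ++ (A.P 2 ++ (A.P 3 ++ [A.x 4, A.x 5])))))

/-- The path through all vertices of the absorber except its root. -/
def avoidingPath : List (Fin n) :=
  A.x 0 :: (A.P 0 ++ (A.x 4 :: (A.P 3 ++ (A.P 2 ++ (A.P 1 ++ [A.x 3, A.x 5])))))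

lemma head?_append_of_eq {p q : List (Fin n)} {a : Fin n} (h : p.head? = some a) :
    (p ++ q).head? = some a := by
  rw [List.head?_append, h]; rfl

lemma pathArcs_absorbingPath : pathArcs A.absorbingPath =
    (A.x 0, v) :: (v, A.x 1) :: (pathArcs (A.P 0) ++ (A.x 2, A.x 3) :: (A.x 3, A.w 0) ::
      (pathArcs (A.P 1) ++ (A.w 3, A.w 4) :: (pathArcs (A.P 2) ++ (A.w 1, A.w 2) ::
        (pathArcs (A.P 3) ++ [(A.w 5, A.x 4), (A.x 4, A.x 5)])))) := by
  obtain ⟨h0, h0', h1, h1', h2, h2', h3, h3'⟩ := A.pathEnds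
  rw [absorbingPath, pathArcs_cons_cons, pathArcs_cons v (head?_append_of_eq h0),
    pathArcs_append (b := A.x 3) h0' rfl, pathArcs_cons _ (head?_append_of_eq h1),
    pathArcs_append h1' (head?_append_of_eq h2), pathArcs_append h2' (head?_append_of_eq h3),
    pathArcs_append (b := A.x 4) h3' rfl]
  rfl

lemma pathArcs_avoidingPath : pathArcs A.avoidingPath =
    (A.x 0, A.x 1) :: (pathArcs (A.P 0) ++ (A.x 2, A.x 4) :: (A.x 4, A.w 2) ::
      (pathArcs (A.P 3) ++ (A.w 5, A.w 4) :: (pathArcs (A.P 2) ++ (A.w 1, A.w 0) ::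
        (pathArcs (A.P 1) ++ [(A.w 3, A.x 3), (A.x 3, A.x 5)])))) := by
  obtain ⟨h0, h0', h1, h1', h2, h2', h3, h3'⟩ := A.pathEnds
  rw [avoidingPath, pathArcs_cons _ (head?_append_of_eq h0),
    pathArcs_append (b := A.x 4) h0' rfl, pathArcs_cons _ (head?_append_of_eq h3),
    pathArcs_append h3' (head?_append_of_eq h2), pathArcs_append h2' (head?_append_of_eq h1),
    pathArcs_append (b := A.x 3) h1' rfl]
  rfl

lemma mem_absorbingPath {a : Fin n} : a ∈ A.absorbingPath ↔ a ∈ A.verts := by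
  simp only [absorbingPath, mem_verts_iff, List.mem_cons, List.mem_append, List.not_mem_nil]
  tauto

lemma mem_avoidingPath {a : Fin n} : a ∈ A.avoidingPath ↔ a ∈ A.verts ∧ a ≠ v := by
  have hP : ∀ i, a ∈ A.P i → a ≠ v := fun i h => (A.mem_path_separate h).1
  have hx : ∀ i, a = A.x i → a ≠ v := fun i h => h ▸ A.x_ne_root i
  simp only [avoidingPath, mem_verts_iff, List.mem_cons, List.mem_append, List.not_mem_nil]
  grind

lemma nodup_interleave {γ : Type*} {s Q₀ Q₁ Q₂ Q₃ l : List γ}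
    (hl : l.Perm (s ++ (Q₀ ++ (Q₁ ++ (Q₂ ++ Q₃))))) (hs : s.Nodup)
    (h₀ : Q₀.Nodup) (h₁ : Q₁.Nodup) (h₂ : Q₂.Nodup) (h₃ : Q₃.Nodup)
    (h₀₁ : ∀ a ∈ Q₀, a ∉ Q₁) (h₀₂ : ∀ a ∈ Q₀, a ∉ Q₂) (h₀₃ : ∀ a ∈ Q₀, a ∉ Q₃)
    (h₁₂ : ∀ a ∈ Q₁, a ∉ Q₂) (h₁₃ : ∀ a ∈ Q₁, a ∉ Q₃) (h₂₃ : ∀ a ∈ Q₂, a ∉ Q₃)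
    (hs₀ : ∀ a ∈ Q₀, a ∉ s) (hs₁ : ∀ a ∈ Q₁, a ∉ s) (hs₂ : ∀ a ∈ Q₂, a ∉ s)
    (hs₃ : ∀ a ∈ Q₃, a ∉ s) : l.Nodup := by
  rw [hl.nodup_iff]
  simp only [List.nodup_append', List.disjoint_left, List.mem_append]
  refine ⟨hs, ⟨h₀, ⟨h₁, ⟨h₂, h₃, fun a => h₂₃ a⟩, ?_⟩, ?_⟩, ?_⟩
  · intro a h; have := h₁₂ a h; have := h₁₃ a h; tauto
  · intro a h; have := h₀₁ a h; have := h₀₂ a h; have := h₀₃ a h; tauto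
  · intro a h
    have := hs₀ a; have := hs₁ a; have := hs₂ a; have := hs₃ a; tauto

lemma absorbingPath_nodup : A.absorbingPath.Nodup := by
  have hd := A.pathsDisjoint
  have hs : ∀ i, ∀ a ∈ A.P i, a ∉ [A.x 0, v, A.x 3, A.x 4, A.x 5] := by
    intro i a ha
    have := A.mem_path_separate ha
    simp only [List.mem_cons, List.not_mem_nil]
    tauto
  refine nodup_interleave (s := [A.x 0, v, A.x 3, A.x 4, A.x 5]) (Q₀ := A.P 0) (Q₁ := A.P 1)
    (Q₂ := A.P 2) (Q₃ := A.P 3) ?_ ?_ (A.pathNodup _) (A.pathNodup _) (A.pathNodup _)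
    (A.pathNodup _) (hd _ _ (by decide)) (hd _ _ (by decide)) (hd _ _ (by decide))
    (hd _ _ (by decide)) (hd _ _ (by decide)) (hd _ _ (by decide)) (hs _) (hs _) (hs _) (hs _)
  · rw [List.perm_iff_count]
    intro a
    simp only [absorbingPath, List.count_cons, List.count_append, List.count_nil]
    omega
  · have := A.gadget.1
    simp only [List.nodup_cons, List.mem_cons, List.not_mem_nil] at this ⊢
    grind

lemma avoidingPath_nodup : A.avoidingPath.Nodup := by
  have hd := A.pathsDisjoint
  have hs : ∀ i, ∀ a ∈ A.P i, a ∉ [A.x 0, A.x 3, A.x 4, A.x 5] := by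
    intro i a ha
    have := A.mem_path_separate ha
    simp only [List.mem_cons, List.not_mem_nil]
    tauto
  refine nodup_interleave (s := [A.x 0, A.x 3, A.x 4, A.x 5]) (Q₀ := A.P 0) (Q₁ := A.P 1)
    (Q₂ := A.P 2) (Q₃ := A.P 3) ?_ ?_ (A.pathNodup _) (A.pathNodup _) (A.pathNodup _)
    (A.pathNodup _) (hd _ _ (by decide)) (hd _ _ (by decide)) (hd _ _ (by decide))
    (hd _ _ (by decide)) (hd _ _ (by decide)) (hd _ _ (by decide)) (hs _) (hs _) (hs _) (hs _)
  · rw [List.perm_iff_count]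
    intro a
    simp only [avoidingPath, List.count_cons, List.count_append, List.count_nil]
    omega
  · have := A.gadget.1
    simp only [List.nodup_cons, List.mem_cons, List.not_mem_nil] at this ⊢
    grind

/-- The eight colours of the absorbing and bridging gadgets. -/
def gadgetColours : List (Fin n) :=
  [c, φ (A.x 0) v, φ v (A.x 1), φ (A.x 0) (A.x 1), φ (A.x 3) (A.w 0), φ (A.w 1) (A.w 0),
    φ (A.w 3) (A.x 3), φ (A.w 3) (A.w 4)]

lemma gadgetColours_nodup : A.gadgetColours.Nodup := by
  have hA := A.gadget.2.2.2.2.2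
  have hB := A.bridge.2.2.2.2.2
  have hc := A.gadget.2.2.2.2.1
  have hperm : A.gadgetColours.Perm ([φ (A.x 0) v, φ v (A.x 1), φ (A.x 0) (A.x 1), c] ++
      [φ (A.x 3) (A.w 0), φ (A.w 1) (A.w 0), φ (A.w 3) (A.x 3), φ (A.w 3) (A.w 4)]) := by
    rw [List.perm_iff_count]
    intro a
    simp only [gadgetColours, List.count_cons, List.count_append, List.count_nil]
    omega
  rw [hperm.nodup_iff, List.nodup_append']
  refine ⟨hA, hB, fun d hd hd' => A.colourDisjointAB d ?_ ?_⟩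
  · simp only [List.mem_cons, List.not_mem_nil, ← hc] at hd
    unfold absGadgetHasColour
    tauto
  · simp only [List.mem_cons, List.not_mem_nil] at hd'
    unfold bridgeHasColour
    tauto

lemma notMem_gadgetColours (i : Fin 4) (d : Fin n) (hd : d ∈ pathColours φ (A.P i)) :
    d ∉ A.gadgetColours := by
  have := A.pathColoursNew i d hd
  have hc := A.gadget.2.2.2.2.1
  unfold absGadgetHasColour bridgeHasColour at this
  simp only [gadgetColours, List.mem_cons, List.not_mem_nil]
  grind

lemma pathColours_absorbingPath_perm : (pathColours φ A.absorbingPath).Perm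
    (A.gadgetColours ++ (pathColours φ (A.P 0) ++ (pathColours φ (A.P 1) ++
      (pathColours φ (A.P 2) ++ pathColours φ (A.P 3))))) := by
  obtain ⟨-, h1, h2, h3, h4, -⟩ := A.gadget
  obtain ⟨-, g1, g2, g3, g4, -⟩ := A.bridge
  rw [List.perm_iff_count]
  intro a
  simp only [pathColours, pathArcs_absorbingPath, gadgetColours, List.map_cons, List.map_append,
    List.map_nil, List.count_cons, List.count_append, List.count_nil, ← h3, h4, ← g2, ← g3]
  omega

lemma pathColours_avoidingPath_perm : (pathColours φ A.avoidingPath).Perm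
    (A.gadgetColours.tail ++ (pathColours φ (A.P 0) ++ (pathColours φ (A.P 1) ++
      (pathColours φ (A.P 2) ++ pathColours φ (A.P 3))))) := by
  obtain ⟨-, h1, h2, h3, h4, -⟩ := A.gadget
  obtain ⟨-, g1, g2, g3, g4, -⟩ := A.bridge
  rw [List.perm_iff_count]
  intro a
  simp only [pathColours, pathArcs_avoidingPath, gadgetColours, List.map_cons, List.map_append,
    List.map_nil, List.count_cons, List.count_append, List.count_nil, List.tail_cons,
    ← h1, ← h2, ← g1, ← g4]
  omega

lemma pathColours_absorbingPath_nodup : (pathColours φ A.absorbingPath).Nodup :=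
  nodup_interleave A.pathColours_absorbingPath_perm A.gadgetColours_nodup
    (A.pathsRainbowEach _) (A.pathsRainbowEach _) (A.pathsRainbowEach _) (A.pathsRainbowEach _)
    (A.pathsRainbowPair _ _ (by decide)) (A.pathsRainbowPair _ _ (by decide))
    (A.pathsRainbowPair _ _ (by decide)) (A.pathsRainbowPair _ _ (by decide))
    (A.pathsRainbowPair _ _ (by decide)) (A.pathsRainbowPair _ _ (by decide))
    (A.notMem_gadgetColours _) (A.notMem_gadgetColours _) (A.notMem_gadgetColours _)
    (A.notMem_gadgetColours _)

lemma pathColours_avoidingPath_nodup : (pathColours φ A.avoidingPath).Nodup :=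
  have ht (i : Fin 4) (d : Fin n) (hd : d ∈ pathColours φ (A.P i)) : d ∉ A.gadgetColours.tail :=
    fun h => A.notMem_gadgetColours i d hd (List.mem_of_mem_tail h)
  nodup_interleave A.pathColours_avoidingPath_perm A.gadgetColours_nodup.tail
    (A.pathsRainbowEach _) (A.pathsRainbowEach _) (A.pathsRainbowEach _) (A.pathsRainbowEach _)
    (A.pathsRainbowPair _ _ (by decide)) (A.pathsRainbowPair _ _ (by decide))
    (A.pathsRainbowPair _ _ (by decide)) (A.pathsRainbowPair _ _ (by decide))
    (A.pathsRainbowPair _ _ (by decide)) (A.pathsRainbowPair _ _ (by decide))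
    (ht _) (ht _) (ht _) (ht _)

lemma rootColour_notMem_avoidingPath : c ∉ pathColours φ A.avoidingPath := by
  intro h
  rw [A.pathColours_avoidingPath_perm.mem_iff] at h
  have hn := A.gadgetColours_nodup
  have hc : c ∈ A.gadgetColours := List.mem_cons_self
  simp only [List.mem_append] at h
  rcases h with h | h | h | h | h
  · exact (List.nodup_cons.1 hn).1 h
  all_goals exact A.notMem_gadgetColours _ _ h hc

lemma pathArcs_subset_arcs (i : Fin 4) {e : Fin n × Fin n} (he : e ∈ pathArcs (A.P i)) :
    e ∈ A.arcs :=
  Finset.mem_union_right _ (Finset.mem_biUnion.2 ⟨i, Finset.mem_univ _, by simpa using he⟩)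

lemma absorbingPath_arcs {e : Fin n × Fin n} (he : e ∈ pathArcs A.absorbingPath) :
    e ∈ A.arcs := by
  simp only [pathArcs_absorbingPath, List.mem_cons, List.mem_append, List.not_mem_nil,
    or_false] at he
  rcases he with rfl | rfl | h | rfl | rfl | h | rfl | h | rfl | h | rfl | rfl
  all_goals first
    | exact A.pathArcs_subset_arcs _ h
    | simp [Absorber.arcs]

lemma avoidingPath_arcs {e : Fin n × Fin n} (he : e ∈ pathArcs A.avoidingPath) :
    e ∈ A.arcs := by
  simp only [pathArcs_avoidingPath, List.mem_cons, List.mem_append, List.not_mem_nil,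
    or_false] at he
  rcases he with rfl | h | rfl | rfl | h | rfl | h | rfl | h | rfl | rfl
  all_goals first
    | exact A.pathArcs_subset_arcs _ h
    | simp [Absorber.arcs]

/-- An absorber contains a rainbow path with prescribed ends that spans its vertices, where the
root and the root colour may be either both used or both avoided. -/
lemma exists_spanning_path (use : Prop) :
    ∃ p : List (Fin n), p.Nodup ∧ p.head? = some A.initial ∧ p.getLast? = some A.terminal ∧
      (∀ a, a ∈ p ↔ a ∈ A.verts ∧ (a = v → use)) ∧ (∀ e ∈ pathArcs p, e ∈ A.arcs) ∧
      (pathColours φ p).Nodup ∧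
      ∀ d ∈ pathColours φ p, d ∈ A.colours ∧ (d = c → use) := by
  have hcol : ∀ p : List (Fin n), (∀ e ∈ pathArcs p, e ∈ A.arcs) →
      ∀ d ∈ pathColours φ p, d ∈ A.colours := by
    intro p hp d hd
    obtain ⟨e, he, rfl⟩ := List.mem_map.1 hd
    exact Finset.mem_image.2 ⟨e, hp e he, rfl⟩
  by_cases h : use
  · refine ⟨A.absorbingPath, A.absorbingPath_nodup, rfl, ?_, ?_, fun e => A.absorbingPath_arcs,
      A.pathColours_absorbingPath_nodup, fun d hd =>
        ⟨hcol _ (fun e => A.absorbingPath_arcs) d hd, fun _ => h⟩⟩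
    · simp [absorbingPath, Absorber.terminal, List.getLast?_cons, List.getLast?_append]
    · intro a
      rw [mem_absorbingPath]
      exact ⟨fun ha => ⟨ha, fun _ => h⟩, And.left⟩
  · refine ⟨A.avoidingPath, A.avoidingPath_nodup, rfl, ?_, ?_, fun e => A.avoidingPath_arcs,
      A.pathColours_avoidingPath_nodup, fun d hd =>
        ⟨hcol _ (fun e => A.avoidingPath_arcs) d hd, ?_⟩⟩
    · simp [avoidingPath, Absorber.terminal, List.getLast?_cons, List.getLast?_append]
    · intro a
      rw [mem_avoidingPath]
      exact and_congr_right fun _ => ⟨fun hv h' => absurd h' hv, fun hv h' => h (hv h')⟩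
    · rintro rfl
      exact absurd hd A.rootColour_notMem_avoidingPath

end Absorber

namespace TAbsorber

variable {n : ℕ} {φ : Fin n → Fin n → Fin n} {α β : Type} [Fintype α] [Fintype β]
  [DecidableEq α] [DecidableEq β] {T : Finset (α × β)} {H : Finset (Fin n × Fin n)}
  (𝔸 : TAbsorber n φ T H)

lemma exists_es_eq {e : α × β} (he : e ∈ T) : ∃ i, 𝔸.es i = e := by
  have h : Finset.univ.image 𝔸.es = T := by
    refine Finset.eq_of_subset_of_card_le ?_ ?_
    · intro x hx
      obtain ⟨i, -, rfl⟩ := Finset.mem_image.1 hx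
      exact 𝔸.esMem i
    · rw [Finset.card_image_of_injective _ 𝔸.esInj, Finset.card_univ, Fintype.card_fin]
  rw [← h] at he
  obtain ⟨i, -, hi⟩ := Finset.mem_image.1 he
  exact ⟨i, hi⟩

lemma mem_arcVerts {a : Fin n} : a ∈ arcVerts H ↔
    (∃ e he, a ∈ (𝔸.Ab e he).verts) ∨ ∃ i, a ∈ 𝔸.link i := by
  have hH : ∀ e, e ∈ H ↔ (∃ f hf, e ∈ (𝔸.Ab f hf).arcs) ∨ ∃ i, e ∈ pathArcs (𝔸.link i) := by
    intro e
    have h := Finset.ext_iff.1 𝔸.minimal e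
    simpa using h
  have hmem : ∀ S : Finset (Fin n × Fin n), a ∈ arcVerts S ↔ ∃ e ∈ S, a = e.1 ∨ a = e.2 := by
    intro S
    simp only [arcVerts, Finset.mem_union, Finset.mem_image]
    constructor
    · rintro (⟨e, he, rfl⟩ | ⟨e, he, rfl⟩)
      exacts [⟨e, he, Or.inl rfl⟩, ⟨e, he, Or.inr rfl⟩]
    · rintro ⟨e, he, h | h⟩
      exacts [Or.inl ⟨e, he, h.symm⟩, Or.inr ⟨e, he, h.symm⟩]
  simp only [← Absorber.arcVerts_arcs, hmem, hH]
  constructor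
  · rintro ⟨e, ⟨f, hf, h⟩ | ⟨i, h⟩, ha⟩
    · exact Or.inl ⟨f, hf, e, h, ha⟩
    · refine Or.inr ⟨i, ?_⟩
      rcases ha with rfl | rfl
      exacts [(mem_of_mem_pathArcs h).1, (mem_of_mem_pathArcs h).2]
  · rintro (⟨f, hf, e, h, ha⟩ | ⟨i, h⟩)
    · exact ⟨e, Or.inl ⟨f, hf, h⟩, ha⟩
    · obtain ⟨e, he, ha⟩ := exists_mem_pathArcs (by rw [𝔸.linkLen]; omega) h
      exact ⟨e, Or.inr ⟨i, he⟩, ha⟩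

/-- A root vertex incident with an edge of `T` lies only in the absorbers of its own edges. -/
lemma eq_of_root_mem_verts {a : α} (ha : ∃ e ∈ T, e.1 = a) {e : α × β} (he : e ∈ T)
    (h : 𝔸.fV a ∈ (𝔸.Ab e he).verts) : e.1 = a := by
  obtain ⟨f, hf, rfl⟩ := ha
  by_cases hef : e = f
  · rw [hef]
  · exact (𝔸.AbVertexDisjoint e he f hf hef _ h (𝔸.Ab f hf).root_mem_verts).1

lemma eq_of_rootColour_mem_colours {b : β} (hb : ∃ e ∈ T, e.2 = b) {e : α × β} (he : e ∈ T)
    (h : 𝔸.fC b ∈ (𝔸.Ab e he).colours) : e.2 = b := by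
  obtain ⟨f, hf, rfl⟩ := hb
  by_cases hef : e = f
  · rw [hef]
  · exact (𝔸.AbColourDisjoint e he f hf hef _ h (𝔸.Ab f hf).rootColour_mem_colours).1

lemma root_notMem_link {a : α} (ha : ∃ e ∈ T, e.1 = a) (i : Fin (T.card - 1)) :
    𝔸.fV a ∉ 𝔸.link i := by
  intro h
  rcases mem_internalVerts_or (𝔸.linkHead i) (𝔸.linkLast i) h with h | h | h
  · have ht := 𝔸.eq_of_root_mem_verts ha (𝔸.esMem _)
      (by rw [h]; exact Absorber.terminal_mem_verts _)
    rw [← ht] at h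
    exact (𝔸.Ab _ (𝔸.esMem _)).x_ne_root 5 h.symm
  · have ht := 𝔸.eq_of_root_mem_verts ha (𝔸.esMem _)
      (by rw [h]; exact Absorber.initial_mem_verts _)
    rw [← ht] at h
    exact (𝔸.Ab _ (𝔸.esMem _)).x_ne_root 0 h.symm
  · obtain ⟨e, he, rfl⟩ := ha
    exact 𝔸.linkInternalDisjoint i _ h e he (𝔸.Ab e he).root_mem_verts

/-- A matching `M` of `T` selects, in each absorber, whether to absorb or to avoid its root. -/
lemma exists_path_of_matching (hT : 0 < T.card) (hα : ∀ a : α, ∃ e ∈ T, e.1 = a)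
    (hβ : ∀ b : β, ∃ e ∈ T, e.2 = b) (M : Finset (α × β)) (hMT : M ⊆ T)
    (hM₁ : ∀ e ∈ M, ∀ f ∈ M, e.1 = f.1 → e = f) (hM₂ : ∀ e ∈ M, ∀ f ∈ M, e.2 = f.2 → e = f) :
    ∃ p : List (Fin n), p.Nodup ∧ p.head? = some (𝔸.initialVtx hT) ∧
      p.getLast? = some (𝔸.terminalVtx hT) ∧ (∀ e ∈ pathArcs p, e ∈ H) ∧
      (∀ u, u ∈ p ↔ u ∈ arcVerts H ∧ ∀ a, u = 𝔸.fV a → ∃ e ∈ M, e.1 = a) ∧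
      (pathColours φ p).Nodup ∧
      ∀ b, 𝔸.fC b ∈ pathColours φ p → ∃ e ∈ M, e.2 = b := by
  choose S hSnd hSh hSl hSm hSa hSc hSd using fun i : Fin T.card =>
    (𝔸.Ab (𝔸.es i) (𝔸.esMem i)).exists_spanning_path (𝔸.es i ∈ M)
  have hSL : ∀ i j, ∀ d ∈ pathColours φ (𝔸.link i), d ∉ pathColours φ (S j) :=
    fun i j d hd hd' => 𝔸.linkColourNew i d hd _ _ (hSd j d hd').1
  obtain ⟨p, hnd, hh, hl, hmem, harcs, hcol⟩ := exists_chained_path φ S 𝔸.link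
    (fun i => (𝔸.Ab (𝔸.es i) (𝔸.esMem i)).initial)
    (fun i => (𝔸.Ab (𝔸.es i) (𝔸.esMem i)).terminal) hSh hSl hSnd
    (by
      intro i j hij u hi hj
      obtain ⟨hi1, hi2⟩ := (hSm i u).1 hi
      obtain ⟨hj1, hj2⟩ := (hSm j u).1 hj
      have hne : 𝔸.es i ≠ 𝔸.es j := fun h => hij (𝔸.esInj h)
      obtain ⟨h1, h2⟩ := 𝔸.AbVertexDisjoint _ _ _ _ hne u hi1 hj1
      exact hne (hM₁ _ (hi2 h2) _ (hj2 (h1 ▸ h2)) h1))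
    hSc
    (by
      intro i j hij d hi hj
      obtain ⟨hi1, hi2⟩ := hSd i d hi
      obtain ⟨hj1, hj2⟩ := hSd j d hj
      have hne : 𝔸.es i ≠ 𝔸.es j := fun h => hij (𝔸.esInj h)
      obtain ⟨h1, h2⟩ := 𝔸.AbColourDisjoint _ _ _ _ hne d hi1 hj1
      exact hne (hM₂ _ (hi2 h2) _ (hj2 (h1 ▸ h2)) h1))
    𝔸.linkLen 𝔸.linkNodup 𝔸.linkPairwiseDisjoint 𝔸.linkRainbowEach 𝔸.linkRainbowPair hSL
    𝔸.linkHead 𝔸.linkLast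
    (fun i a ha j hj => 𝔸.linkInternalDisjoint i a ha _ _ ((hSm j a).1 hj).1)
    (T.card - 1) (by omega)
  have hle : ∀ i : Fin T.card, i.1 ≤ T.card - 1 := fun i => by omega
  simp only [hle, true_and, Fin.is_lt] at hmem harcs
  refine ⟨p, hnd, hh, hl, fun e he => ?_, fun u => ?_, hcol, fun b hb => ?_⟩
  · rcases (harcs e).1 he with ⟨i, hi⟩ | ⟨i, hi⟩
    · exact 𝔸.AbSub _ _ (hSa i e hi)
    · exact 𝔸.linkSub i e hi
  · rw [hmem, 𝔸.mem_arcVerts]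
    constructor
    · rintro (⟨i, hi⟩ | ⟨i, hi⟩)
      · obtain ⟨h1, h2⟩ := (hSm i u).1 hi
        refine ⟨Or.inl ⟨_, _, h1⟩, ?_⟩
        rintro a rfl
        have ha := 𝔸.eq_of_root_mem_verts (hα a) _ h1
        exact ⟨𝔸.es i, h2 (by rw [ha]), ha⟩
      · refine ⟨Or.inr ⟨i, hi⟩, ?_⟩
        rintro a rfl
        exact absurd hi (𝔸.root_notMem_link (hα a) i)
    · rintro ⟨⟨e, he, h⟩ | h, ha⟩
      · left
        by_cases hu : u = 𝔸.fV e.1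
        · obtain ⟨f, hf, hfe⟩ := ha _ hu
          obtain ⟨i, rfl⟩ := 𝔸.exists_es_eq (hMT hf)
          refine ⟨i, (hSm i u).2 ⟨?_, fun _ => hf⟩⟩
          rw [hu, ← hfe]
          exact Absorber.root_mem_verts _
        · obtain ⟨i, rfl⟩ := 𝔸.exists_es_eq he
          exact ⟨i, (hSm i u).2 ⟨h, fun h' => absurd h' hu⟩⟩
      · exact Or.inr h
  · obtain ⟨e, he, hd⟩ := List.mem_map.1 hb
    rcases (harcs e).1 he with ⟨i, hi⟩ | ⟨i, hi⟩
    · obtain ⟨h1, h2⟩ := hSd i _ (List.mem_map.2 ⟨e, hi, hd⟩)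
      have hb' := 𝔸.eq_of_rootColour_mem_colours (hβ b) _ h1
      exact ⟨𝔸.es i, h2 (by rw [hb']), hb'⟩
    · obtain ⟨f, hf, rfl⟩ := hβ b
      exact absurd (𝔸.Ab f hf).rootColour_mem_colours
        (𝔸.linkColourNew i _ (List.mem_map.2 ⟨e, hi, hd⟩) f hf)

end TAbsorber

/-- If `T` is robustly matchable with respect to flexible sets `A'`,
`B'`, then any `T`-absorber `H ⊆ G` is robustly rainbow-Hamiltonian with respect to the
corresponding root vertices and colours and its initial and terminal vertices. -/
theorem statement_11 {n : ℕ} (G : Colouring n) {α β : Type}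
    [Fintype α] [Fintype β] [DecidableEq α] [DecidableEq β]
    (hαβ : Fintype.card α = Fintype.card β)
    (T : Finset (α × β)) (hT : 0 < T.card)
    (H : Finset (Fin n × Fin n)) (𝔸 : TAbsorber n G.1 T H)
    (A' : Finset α) (B' : Finset β)
    (hrm : RobustlyMatchable T A' B') :
    RobustlyRainbowHam G.1 H (A'.image 𝔸.fV) (B'.image 𝔸.fC)
      (𝔸.initialVtx hT) (𝔸.terminalVtx hT) := by
  intro X Y hX hY hXY hcard
  obtain ⟨X₀, hX₀, rfl⟩ := Finset.subset_image_iff.1 hX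
  obtain ⟨Y₀, hY₀, rfl⟩ := Finset.subset_image_iff.1 hY
  simp only [Finset.card_image_of_injective _ 𝔸.fVinj,
    Finset.card_image_of_injective _ 𝔸.fCinj] at hXY hcard
  obtain ⟨M₀, hM₀, -, hM₀α, hM₀β⟩ := hrm ∅ ∅ (by simp) (by simp) rfl (by
    rw [Finset.card_empty, Nat.cast_zero]; positivity)
  obtain ⟨M, hM, hMXY, hMα, hMβ⟩ := hrm X₀ Y₀ (by simpa using hX₀) (by simpa using hY₀) hXY hcard
  obtain ⟨p, hnd, hh, hl, harcs, hmem, hcol, hroot⟩ := 𝔸.exists_path_of_matching hT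
    (fun a => by
      obtain ⟨e, ⟨he, h⟩, -⟩ := hM₀α a (by simp)
      exact ⟨e, hM₀ he, h⟩)
    (fun b => by
      obtain ⟨e, ⟨he, h⟩, -⟩ := hM₀β b (by simp)
      exact ⟨e, hM₀ he, h⟩)
    M hM
    (fun e he f hf h => (hMα e.1 (hMXY e he).1).unique ⟨he, rfl⟩ ⟨hf, h.symm⟩)
    (fun e he f hf h => (hMβ e.2 (hMXY e he).2).unique ⟨he, rfl⟩ ⟨hf, h.symm⟩)
  have hpX : ∀ u ∈ p, u ∉ X₀.image 𝔸.fV := by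
    intro u hu huX
    obtain ⟨a, ha, rfl⟩ := Finset.mem_image.1 huX
    obtain ⟨e, he, rfl⟩ := ((hmem _).1 hu).2 a rfl
    exact (hMXY e he).1 ha
  refine ⟨p, hnd, hh, hl, harcs, hpX, ?_, hcol, ?_⟩
  · ext u
    rw [List.mem_toFinset, Finset.mem_sdiff]
    refine ⟨fun hu => ⟨((hmem u).1 hu).1, hpX u hu⟩, fun ⟨hu, huX⟩ => (hmem u).2 ⟨hu, ?_⟩⟩
    rintro a rfl
    obtain ⟨e, ⟨he, h⟩, -⟩ := hMα a fun ha => huX (Finset.mem_image_of_mem _ ha)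
    exact ⟨e, he, h⟩
  · intro d hd hdY
    obtain ⟨b, hb, rfl⟩ := Finset.mem_image.1 hdY
    obtain ⟨e, he, rfl⟩ := hroot b hd
    exact (hMXY e he).2 hb

end RandomLatin
end
end

section
/- For all sufficiently large n the following holds. For every G ∈ Φ(K_n^↔) and all distinct vertices u, v ∈ [n], there are at least n²/3 rainbow directed paths of length three in G with tail u and head v. -/
open scoped Classical

noncomputable section

namespace RandomLatin

theorem card_filter_le_of_injOn_fst {n : ℕ} (R : Fin n × Fin n → Prop)
    (h : ∀ a b b', R (a, b) → R (a, b') → b = b') :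
    (Finset.univ.filter R).card ≤ n := by
  refine (Finset.card_le_card_of_injOn Prod.fst (t := Finset.univ) (by simp) ?_).trans
    (by simp)
  rintro ⟨a, b⟩ hp ⟨a', b'⟩ hq (rfl : a = a')
  have hp' : R (a, b) := by simpa using hp
  have hq' : R (a, b') := by simpa using hq
  rw [h a b b' hp' hq']

theorem card_filter_le_of_injOn_snd {n : ℕ} (R : Fin n × Fin n → Prop)
    (h : ∀ a a' b, R (a, b) → R (a', b) → a = a') :
    (Finset.univ.filter R).card ≤ n := by
  refine (Finset.card_le_card_of_injOn Prod.snd (t := Finset.univ) (by simp) ?_).trans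
    (by simp)
  rintro ⟨a, b⟩ hp ⟨a', b'⟩ hq (rfl : b = b')
  have hp' : R (a, b) := by simpa using hp
  have hq' : R (a', b) := by simpa using hq
  rw [h a a' b hp' hq']

theorem card_union_le_of_card_le {α : Type*} {s t : Finset α} {k m : ℕ}
    (hs : s.card ≤ k) (ht : t.card ≤ m) : (s ∪ t).card ≤ k + m :=
  (Finset.card_union_le s t).trans (add_le_add hs ht)

/-- At most `8n` pairs fail to be the interior of a rainbow path of length three. -/
theorem card_not_rainbow_path_le {n : ℕ} {φ : Fin n → Fin n → Fin n} (hφ : IsProper φ)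
    {u v : Fin n} (huv : u ≠ v) :
    (Finset.univ.filter fun p : Fin n × Fin n =>
      ¬ (([u, p.1, p.2, v] : List (Fin n)).Nodup ∧
        ([φ u p.1, φ p.1 p.2, φ p.2 v] : List (Fin n)).Nodup)).card ≤ 8 * n := by
  obtain ⟨hr, hc⟩ := hφ
  have hu₁ := card_filter_le_of_injOn_snd (fun p : Fin n × Fin n => p.1 = u) (by grind)
  have hv₁ := card_filter_le_of_injOn_snd (fun p : Fin n × Fin n => p.1 = v) (by grind)
  have hu₂ := card_filter_le_of_injOn_fst (fun p : Fin n × Fin n => p.2 = u) (by grind)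
  have hv₂ := card_filter_le_of_injOn_fst (fun p : Fin n × Fin n => p.2 = v) (by grind)
  have hw := card_filter_le_of_injOn_fst (fun p : Fin n × Fin n => p.1 = p.2) (by grind)
  have h₁₂ := card_filter_le_of_injOn_fst (fun p : Fin n × Fin n => φ u p.1 = φ p.1 p.2)
    fun a b b' h h' => hr a b b' (h.symm.trans h')
  have h₁₃ := card_filter_le_of_injOn_fst (fun p : Fin n × Fin n => φ u p.1 = φ p.2 v)
    fun a b b' h h' => hc b b' v (h.symm.trans h')
  have h₂₃ := card_filter_le_of_injOn_snd (fun p : Fin n × Fin n => φ p.1 p.2 = φ p.2 v)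
    fun a a' b h h' => hc a a' b (h.trans h'.symm)
  have hunion := card_union_le_of_card_le hu₁ <| card_union_le_of_card_le hv₁ <|
    card_union_le_of_card_le hu₂ <| card_union_le_of_card_le hv₂ <|
    card_union_le_of_card_le hw <| card_union_le_of_card_le h₁₂ <|
    card_union_le_of_card_le h₁₃ h₂₃
  refine ((Finset.card_le_card ?_).trans hunion).trans (by omega)
  intro p hp
  simp only [Finset.mem_union, Finset.mem_filter, Finset.mem_univ, true_and,
    List.nodup_cons, List.mem_cons, List.not_mem_nil, or_false,
    List.nodup_nil, and_true, not_false_eq_true] at hp ⊢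
  grind

/-- For all large `n`, every proper `n`-arc-colouring and all distinct
`u, v`, there are at least `n²/3` rainbow directed length-three paths from `u` to `v`. -/
theorem statement_12 :
    ∃ n₀ : ℕ, ∀ n : ℕ, n₀ ≤ n → ∀ G : Colouring n, ∀ u v : Fin n, u ≠ v →
      (n : ℝ) ^ 2 / 3 ≤
        (Nat.card {p : Fin n × Fin n //
          ([u, p.1, p.2, v] : List (Fin n)).Nodup ∧
          ([G.1 u p.1, G.1 p.1 p.2, G.1 p.2 v] : List (Fin n)).Nodup} : ℝ) := by
  refine ⟨12, fun n hn G u v huv => ?_⟩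
  have hbad := card_not_rainbow_path_le G.2 huv
  have hsum := Finset.card_filter_add_card_filter_not (s := Finset.univ)
    (fun p : Fin n × Fin n => ([u, p.1, p.2, v] : List (Fin n)).Nodup ∧
      ([G.1 u p.1, G.1 p.1 p.2, G.1 p.2 v] : List (Fin n)).Nodup)
  rw [Finset.card_univ, Fintype.card_prod, Fintype.card_fin] at hsum
  rw [Nat.card_eq_fintype_card, Fintype.card_subtype]
  have hn' : (12 : ℝ) ≤ n := by exact_mod_cast hn
  rify at hbad hsum
  nlinarith

end RandomLatin
end
end

section
/- For all sufficiently large n the following holds. Let G ∈ Φ(K_n^↔), let u, v ∈ [n] be distinct, and let c ∈ [n] be a colour such that at most n/2 loops of G have colour c. Then there are at least n²/5 rainbow directed paths of length four in G with tail u and head v whose second arc has colour c. -/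
open scoped Classical

noncomputable section

namespace RandomLatin

/-- A relation in which one coordinate determines the other has at most `|α|` pairs. -/
theorem card_filter_rel_le {α : Type*} [Fintype α] (R : α → α → Prop)
    (hR : Relator.LeftUnique R ∨ Relator.RightUnique R) :
    (Finset.univ.filter fun p : α × α => R p.1 p.2).card ≤ Fintype.card α := by
  rcases hR with h | h
  · refine Finset.card_le_card_of_injOn Prod.snd (fun _ _ => Finset.mem_univ _) ?_
    rintro ⟨a, b⟩ hp ⟨a', b'⟩ hq (rfl : b = b')
    simp only [Finset.coe_filter, Finset.mem_univ, true_and, Set.mem_ofPred_eq] at hp hq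
    rw [h hp hq]
  · refine Finset.card_le_card_of_injOn Prod.fst (fun _ _ => Finset.mem_univ _) ?_
    rintro ⟨a, b⟩ hp ⟨a', b'⟩ hq (rfl : a = a')
    simp only [Finset.coe_filter, Finset.mem_univ, true_and, Set.mem_ofPred_eq] at hp hq
    rw [h hp hq]

theorem card_filter_exists_rel_le {α : Type*} [Fintype α] (l : List (α → α → Prop))
    (hl : ∀ R ∈ l, Relator.LeftUnique R ∨ Relator.RightUnique R) :
    (Finset.univ.filter fun p : α × α => ∃ R ∈ l, R p.1 p.2).card ≤
      l.length * Fintype.card α := by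
  induction l with
  | nil => simp
  | cons R l ih =>
    have h₁ := card_filter_rel_le R (hl R (by simp))
    have h₂ := ih fun S hS => hl S (by simp [hS])
    have hsub : (Finset.univ.filter fun p : α × α => ∃ S ∈ R :: l, S p.1 p.2) ⊆
        (Finset.univ.filter fun p : α × α => R p.1 p.2) ∪
          Finset.univ.filter fun p : α × α => ∃ S ∈ l, S p.1 p.2 := by
      intro p hp
      simpa using hp
    have h₃ := (Finset.card_le_card hsub).trans (Finset.card_union_le _ _)
    rw [List.length_cons, Nat.succ_mul]
    omega

/-- The number of rainbow directed length-four paths from `u` to `v` with second arc of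
colour `c` is at least `n²`, minus `n` times the number of `c`-loops, minus `14n`. -/
theorem sq_le_card_rainbow_paths {n : ℕ} (G : Colouring n) {u v : Fin n} (huv : u ≠ v)
    (c : Fin n) :
    n * n ≤ Nat.card {p : Fin n × Fin n × Fin n //
          ([u, p.1, p.2.1, p.2.2, v] : List (Fin n)).Nodup ∧
          G.1 p.1 p.2.1 = c ∧
          ([G.1 u p.1, G.1 p.1 p.2.1, G.1 p.2.1 p.2.2, G.1 p.2.2 v] :
            List (Fin n)).Nodup} + loopCount G.1 c * n + 14 * n := by
  obtain ⟨φ, hrow, hcol⟩ := G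
  have hex : ∀ a, ∃ b, φ a b = c := fun a =>
    Finite.surjective_of_injective (fun _ _ h => hrow a _ _ h) c
  choose σ hσ using hex
  have hσinj : ∀ a a', σ a = σ a' → a = a' := fun a a' h =>
    hcol a a' (σ a) (by rw [hσ, h, hσ])
  let l : List (Fin n → Fin n → Prop) :=
    [fun a _ => a = u, fun a _ => a = v, fun a _ => σ a = u, fun a _ => σ a = v,
      fun _ b => b = u, fun _ b => b = v, fun a b => a = b, fun a b => σ a = b,
      fun a _ => φ u a = c, fun _ b => φ b v = c, fun a b => φ (σ a) b = c,
      fun a b => φ (σ a) b = φ u a, fun a b => φ b v = φ u a,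
      fun a b => φ (σ a) b = φ b v]
  have hl : ∀ R ∈ l, Relator.LeftUnique R ∨ Relator.RightUnique R := by
    simp only [l, List.forall_mem_cons, List.not_mem_nil, false_imp_iff, implies_true,
      and_true, Relator.LeftUnique, Relator.RightUnique]
    refine ⟨.inl ?_, .inl ?_, .inl ?_, .inl ?_, .inr ?_, .inr ?_, .inl ?_, .inl ?_,
      .inl ?_, .inr ?_, .inr ?_, .inr ?_, .inr ?_, .inl ?_⟩ <;> intro x y z h h'
    · exact h.trans h'.symm
    · exact h.trans h'.symm
    · exact hσinj _ _ (h.trans h'.symm)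
    · exact hσinj _ _ (h.trans h'.symm)
    · exact h.trans h'.symm
    · exact h.trans h'.symm
    · exact h.trans h'.symm
    · exact hσinj _ _ (h.trans h'.symm)
    · exact hrow _ _ _ (h.trans h'.symm)
    · exact hcol _ _ _ (h.trans h'.symm)
    · exact hrow _ _ _ (h.trans h'.symm)
    · exact hrow _ _ _ (h.trans h'.symm)
    · exact hcol _ _ _ (h.trans h'.symm)
    · exact hσinj _ _ (hcol _ _ _ (h.trans h'.symm))
  have hbad := card_filter_exists_rel_le l hl
  set bad := Finset.univ.filter fun p : Fin n × Fin n => ∃ R ∈ l, R p.1 p.2 with hbad_def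
  let loops := (Finset.univ.filter fun i : Fin n => φ i i = c) ×ˢ (Finset.univ : Finset (Fin n))
  have hloops : loops.card = loopCount φ c * n := by
    simp [loops, loopCount, Finset.card_product, Fintype.card_subtype]
  rw [Nat.card_eq_fintype_card, Fintype.card_subtype]
  set good := Finset.univ.filter fun p : Fin n × Fin n × Fin n =>
    ([u, p.1, p.2.1, p.2.2, v] : List (Fin n)).Nodup ∧ φ p.1 p.2.1 = c ∧
      ([φ u p.1, φ p.1 p.2.1, φ p.2.1 p.2.2, φ p.2.2 v] : List (Fin n)).Nodup with hgood
  have hcover : (Finset.univ : Finset (Fin n × Fin n)) ⊆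
      good.image (fun p => (p.1, p.2.2)) ∪ loops ∪ bad := by
    rintro ⟨a, b⟩ -
    by_contra hp
    simp only [Finset.mem_union, not_or] at hp
    obtain ⟨⟨hg, hlp⟩, hb⟩ := hp
    have hloop : a ≠ σ a := fun h => hlp (by
      have := hσ a
      rw [← h] at this
      simpa [loops] using this)
    simp only [hbad_def, Finset.mem_filter, Finset.mem_univ, true_and, l, List.mem_cons,
      List.not_mem_nil, or_false, exists_eq_or_imp, exists_eq_left, not_or] at hb
    refine hg (Finset.mem_image.mpr ⟨(a, σ a, b), ?_, rfl⟩)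
    simp only [hgood, Finset.mem_filter, Finset.mem_univ, true_and, List.nodup_cons,
      List.mem_cons, List.not_mem_nil, or_false, not_or, hσ, not_false_eq_true,
      List.nodup_nil, and_true]
    grind
  have hcard := (Finset.card_le_card hcover).trans (Finset.card_union_le _ _)
  have h₁ := Finset.card_union_le (good.image (fun p => (p.1, p.2.2))) loops
  have h₂ : (good.image (fun p => (p.1, p.2.2))).card ≤ good.card := Finset.card_image_le
  simp only [Finset.card_univ, Fintype.card_prod, Fintype.card_fin] at hcard hbad
  have hlen : l.length = 14 := rfl
  rw [hlen] at hbad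
  change n * n ≤ good.card + loopCount φ c * n + 14 * n
  omega

/-- For all large `n`, distinct `u, v` and a colour `c` with at most
`n/2` loops, there are at least `n²/5` rainbow directed length-four paths from `u` to `v`
whose second arc has colour `c`. -/
theorem statement_13 :
    ∃ n₀ : ℕ, ∀ n : ℕ, n₀ ≤ n → ∀ G : Colouring n, ∀ u v : Fin n, u ≠ v →
      ∀ c : Fin n, (loopCount G.1 c : ℝ) ≤ n / 2 →
      (n : ℝ) ^ 2 / 5 ≤
        (Nat.card {p : Fin n × Fin n × Fin n //
          ([u, p.1, p.2.1, p.2.2, v] : List (Fin n)).Nodup ∧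
          G.1 p.1 p.2.1 = c ∧
          ([G.1 u p.1, G.1 p.1 p.2.1, G.1 p.2.1 p.2.2, G.1 p.2.2 v] :
            List (Fin n)).Nodup} : ℝ) := by
  refine ⟨50, fun n hn G u v huv c hc => ?_⟩
  have h := sq_le_card_rainbow_paths G huv c
  have hn' : (50 : ℝ) ≤ n := by exact_mod_cast hn
  rify at h
  nlinarith [mul_le_mul_of_nonneg_right hc (by linarith : (0 : ℝ) ≤ n)]

end RandomLatin
end
end

section
/- For all sufficiently large n the following holds. Let G ∈ Φ(K_n^↔), let u, v ∈ [n] be distinct, and let c ∈ [n]. Then (a) for every vertex w ∈ [n], there are at most 3n rainbow directed paths of length four in G with tail u and head v whose second arc has colour c and which contain w as an internal vertex, and (b) for every colour d ∈ [n] with d ≠ c, there are at most 3n rainbow directed paths of length four in G with tail u and head v whose second arc has colour c and which contain an arc of colour d. -/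
open scoped Classical

noncomputable section

namespace RandomLatin

/-- A subset of a finite type covered by three sets, each of which injects into `Fin n`,
has at most `3 * n` elements. -/
theorem card_subtype_le_three_mul {α : Type*} [Finite α] {n : ℕ} {P : α → Prop}
    (Q : Fin 3 → α → Prop) (f : Fin 3 → α → Fin n) (hPQ : ∀ p, P p → ∃ i, Q i p)
    (hinj : ∀ i p q, P p → P q → Q i p → Q i q → f i p = f i q → p = q) :
    (Nat.card {p // P p} : ℝ) ≤ 3 * n := by
  choose g hg using hPQ
  have h : Nat.card {p // P p} ≤ Nat.card (Fin 3 × Fin n) := by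
    refine Nat.card_le_card_of_injective
      (fun p : {p // P p} => (g p.1 p.2, f (g p.1 p.2) p.1)) ?_
    rintro ⟨p, hp⟩ ⟨q, hq⟩ heq
    obtain ⟨h₁, h₂⟩ := Prod.mk.inj heq
    have hQ := hg p hp
    rw [h₁] at h₂ hQ
    exact Subtype.ext (hinj _ p q hp hq hQ (hg q hq) h₂)
  rw [Nat.card_prod, Nat.card_fin, Nat.card_fin] at h
  exact_mod_cast h

/-- For all large `n`, distinct `u, v` and any colour `c`: (a) every
vertex `w` is an internal vertex of at most `3n` rainbow directed length-four paths from
`u` to `v` whose second arc has colour `c`, and (b) every colour `d ≠ c` appears on at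
most `3n` such paths. -/
theorem statement_15 :
    ∃ n₀ : ℕ, ∀ n : ℕ, n₀ ≤ n → ∀ G : Colouring n, ∀ u v : Fin n, u ≠ v → ∀ c : Fin n,
      (∀ w : Fin n,
        (Nat.card {p : Fin n × Fin n × Fin n //
          (([u, p.1, p.2.1, p.2.2, v] : List (Fin n)).Nodup ∧
            G.1 p.1 p.2.1 = c ∧
            ([G.1 u p.1, G.1 p.1 p.2.1, G.1 p.2.1 p.2.2, G.1 p.2.2 v] :
              List (Fin n)).Nodup) ∧
          (p.1 = w ∨ p.2.1 = w ∨ p.2.2 = w)} : ℝ) ≤ 3 * n) ∧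
      (∀ d : Fin n, d ≠ c →
        (Nat.card {p : Fin n × Fin n × Fin n //
          (([u, p.1, p.2.1, p.2.2, v] : List (Fin n)).Nodup ∧
            G.1 p.1 p.2.1 = c ∧
            ([G.1 u p.1, G.1 p.1 p.2.1, G.1 p.2.1 p.2.2, G.1 p.2.2 v] :
              List (Fin n)).Nodup) ∧
          (d = G.1 u p.1 ∨ d = G.1 p.1 p.2.1 ∨ d = G.1 p.2.1 p.2.2 ∨
            d = G.1 p.2.2 v)} : ℝ) ≤ 3 * n) := by
  refine ⟨0, fun n _ ⟨φ, htail, hhead⟩ u v _ c => ⟨fun w => ?_, fun d hd => ?_⟩⟩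
  · refine card_subtype_le_three_mul
      ![fun p => p.1 = w, fun p => p.2.1 = w, fun p => p.2.2 = w]
      ![fun p => p.2.2, fun p => p.2.2, fun p => p.1] ?_ ?_
    · rintro p ⟨-, h | h | h⟩
      exacts [⟨0, h⟩, ⟨1, h⟩, ⟨2, h⟩]
    · intro i
      match i with
      | 0 =>
        rintro ⟨a, b, e⟩ ⟨a', b', e'⟩ ⟨⟨-, hp, -⟩, -⟩ ⟨⟨-, hq, -⟩, -⟩
          (rfl : a = w) (rfl : a' = a) (rfl : e = e')
        have hc : φ a' b = φ a' b' := hp.trans hq.symm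
        rw [htail _ _ _ hc]
      | 1 =>
        rintro ⟨a, b, e⟩ ⟨a', b', e'⟩ ⟨⟨-, hp, -⟩, -⟩ ⟨⟨-, hq, -⟩, -⟩
          (rfl : b = w) (rfl : b' = b) (rfl : e = e')
        have hc : φ a b' = φ a' b' := hp.trans hq.symm
        rw [hhead _ _ _ hc]
      | 2 =>
        rintro ⟨a, b, e⟩ ⟨a', b', e'⟩ ⟨⟨-, hp, -⟩, -⟩ ⟨⟨-, hq, -⟩, -⟩
          (rfl : e = w) (rfl : e' = e) (rfl : a = a')
        have hc : φ a b = φ a b' := hp.trans hq.symm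
        rw [htail _ _ _ hc]
  · refine card_subtype_le_three_mul
      ![fun p => d = φ u p.1, fun p => d = φ p.2.1 p.2.2, fun p => d = φ p.2.2 v]
      ![fun p => p.2.2, fun p => p.1, fun p => p.1] ?_ ?_
    · rintro p ⟨⟨-, hp, -⟩, h | h | h | h⟩
      exacts [⟨0, h⟩, absurd (h.trans hp) hd, ⟨1, h⟩, ⟨2, h⟩]
    · intro i
      match i with
      | 0 =>
        rintro ⟨a, b, e⟩ ⟨a', b', e'⟩ ⟨⟨-, hp, -⟩, -⟩ ⟨⟨-, hq, -⟩, -⟩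
          (h : d = φ u a) (h' : d = φ u a') (rfl : e = e')
        obtain rfl : a = a' := htail _ _ _ (h.symm.trans h')
        have hc : φ a b = φ a b' := hp.trans hq.symm
        rw [htail _ _ _ hc]
      | 1 =>
        rintro ⟨a, b, e⟩ ⟨a', b', e'⟩ ⟨⟨-, hp, -⟩, -⟩ ⟨⟨-, hq, -⟩, -⟩
          (h : d = φ b e) (h' : d = φ b' e') (rfl : a = a')
        obtain rfl : b = b' := htail _ _ _ (hp.trans hq.symm)
        rw [htail _ _ _ (h.symm.trans h')]
      | 2 =>
        rintro ⟨a, b, e⟩ ⟨a', b', e'⟩ ⟨⟨-, hp, -⟩, -⟩ ⟨⟨-, hq, -⟩, -⟩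
          (h : d = φ e v) (h' : d = φ e' v) (rfl : a = a')
        obtain rfl : b = b' := htail _ _ _ (hp.trans hq.symm)
        rw [hhead _ _ _ (h.symm.trans h')]

end RandomLatin
end
end
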